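/- arXiv:2509.06935 — 3 statements merged into one kernel-verified Lean document; each statement's English description precedes it below -/
import Mathlib

section
/- There exists a constant c > 0 such that for every integer d ≥ 2 there exists a constant C > 0 with the following property: for every n ≥ 3 and every ellipse E in ℝ^d, the number of points of [n]^d lying on E is at most C · n^{c/log log n}. -/
/-- The grid `[n]^d`: points of `ℝ^d` with all coordinates integers in `{1, …, n}`. -/
def grid (d n : ℕ) : Set (EuclideanSpace ℝ (Fin d)) :=
  {x | ∀ i, ∃ m : ℕ, 1 ≤ m ∧ m ≤ n ∧ x i = (m : ℝ)}

/-- An ellipse in `ℝ^d`: the image of the unit circle in `ℝ^2` under an injective affine map. -/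
def IsEllipse (d : ℕ) (E : Set (EuclideanSpace ℝ (Fin d))) : Prop :=
  ∃ φ : EuclideanSpace ℝ (Fin 2) →ᵃ[ℝ] EuclideanSpace ℝ (Fin d),
    Function.Injective φ ∧ E = φ '' Metric.sphere (0 : EuclideanSpace ℝ (Fin 2)) 1


lemma sq_sub_dvd' {q A B : ℤ} (hA : q ∣ A^2) (hB : q ∣ B^2) : q ∣ (A-B)^2 := by
  have h : q^2 ∣ (A*B)^2 := by
    have := mul_dvd_mul hA hB
    rw [mul_pow, sq q]; exact this
  have h2 : q ∣ A*B := (Int.pow_dvd_pow_iff (by norm_num)).1 h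
  have : (A-B)^2 = A^2 + B^2 - 2*(A*B) := by ring
  rw [this]
  exact dvd_sub (dvd_add hA hB) (Dvd.dvd.mul_left h2 _)

lemma caseA {q D X Y X' Y' N : ℤ} (hN : Y^2 + D*X^2 = N) (hN' : Y'^2 + D*X'^2 = N)
    (hq : q ∣ N) (h : q ∣ Y^2) (h' : q ∣ Y'^2) : q^2 ∣ 4*D*(Y*X'-X*Y')^2 := by
  have h1 : q ∣ D*X^2 := by
    have : D*X^2 = N - Y^2 := by linarith
    rw [this]; exact dvd_sub hq h
  have h2 : q ∣ D*X'^2 := by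
    have : D*X'^2 = N - Y'^2 := by linarith
    rw [this]; exact dvd_sub hq h'
  have h3 : q^2 ∣ (D*X*Y*X'*Y') := by
    apply (Int.pow_dvd_pow_iff (n := 2) (by norm_num)).1
    have := mul_dvd_mul (mul_dvd_mul h1 h) (mul_dvd_mul h2 h')
    have e1 : (q^2)^2 = q*q*(q*q) := by ring
    have e2 : (D*X*Y*X'*Y')^2 = D*X^2*Y^2*(D*X'^2*Y'^2) := by ring
    rw [e1, e2]; exact this
  have h4 : q^2 ∣ D*X'^2*Y^2 := by rw [sq]; exact mul_dvd_mul h2 h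
  have h5 : q^2 ∣ D*X^2*Y'^2 := by rw [sq]; exact mul_dvd_mul h1 h'
  have : 4*D*(Y*X'-X*Y')^2 = 4*(D*X'^2*Y^2) + 4*(D*X^2*Y'^2) - 8*(D*X*Y*X'*Y') := by ring
  rw [this]
  exact dvd_sub (dvd_add (h4.mul_left _) (h5.mul_left _)) (h3.mul_left _)

lemma caseB_z {p : ℤ} {j k : ℕ} {D X y N : ℤ} (hp : Prime p) 
    (hN : (p^j*y)^2 + D*X^2 = N) (hq : p^k ∣ N) (hy : ¬ p ∣ y) (hjk : 2*j < k) :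
    ∃ z, D*X^2 = p^(2*j)*z ∧ ¬ p ∣ z := by
  obtain ⟨M, rfl⟩ : ∃ M, N = p^(2*j)*(p*M) := by
    obtain ⟨r, rfl⟩ := hq
    refine ⟨p^(k-(2*j+1))*r, ?_⟩
    rw [← mul_assoc p, ← pow_succ', ← mul_assoc, ← pow_add]
    congr 2; omega
  refine ⟨p*M - y^2, ?_, ?_⟩
  · linear_combination hN
  · intro h
    have : p ∣ y^2 := by
      have := dvd_sub (dvd_mul_right p M) h
      simpa using this
    exact hy (hp.dvd_of_dvd_pow this)

lemma pow_dvd_cancel {p : ℤ} (hp : Prime p) {a b : ℕ} {z w : ℤ} (hz : ¬ p ∣ z)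
    (h : p^(a+b) ∣ p^a*z*w) : p^b ∣ w := by
  rw [pow_add, mul_assoc] at h
  have h1 : p^b ∣ z*w := (mul_dvd_mul_iff_left (pow_ne_zero _ hp.ne_zero)).1 h
  exact hp.pow_dvd_of_dvd_mul_left _ hz h1

lemma trans_B {p : ℤ} {j k : ℕ} {D X Y X' Y' X0 Y0 z z' z0 : ℤ} (hp : Prime p)
    (hz : D*X^2 = p^(2*j)*z) (hz' : D*X'^2 = p^(2*j)*z') (hz0 : D*X0^2 = p^(2*j)*z0)
    (h0 : ¬ p ∣ z0)
    (h1 : p^(2*k) ∣ 4*D*(Y*X0-X*Y0)^2) (h2 : p^(2*k) ∣ 4*D*(Y'*X0-X'*Y0)^2) :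
    p^(2*k) ∣ 4*D*(Y*X'-X*Y')^2 := by
  have e1 : p^(2*j+2*k) ∣ (2*D*X'*(Y*X0-X*Y0))^2 := by
    have : (2*D*X'*(Y*X0-X*Y0))^2 = p^(2*j)*(z'*(4*D*(Y*X0-X*Y0)^2)) := by
      linear_combination (4*D*(Y*X0-X*Y0)^2) * hz'
    rw [this, pow_add]
    exact mul_dvd_mul_left _ (h1.mul_left _)
  have e2 : p^(2*j+2*k) ∣ (2*D*X*(Y'*X0-X'*Y0))^2 := by
    have : (2*D*X*(Y'*X0-X'*Y0))^2 = p^(2*j)*(z*(4*D*(Y'*X0-X'*Y0)^2)) := by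
      linear_combination (4*D*(Y'*X0-X'*Y0)^2) * hz
    rw [this, pow_add]
    exact mul_dvd_mul_left _ (h2.mul_left _)
  have e3 := sq_sub_dvd' e1 e2
  apply pow_dvd_cancel hp h0 (a := 2*j)
  convert e3 using 1
  linear_combination (-4*D*(Y*X'-X*Y')^2) * hz0

lemma exists_fac {p : ℤ} (hp : Prime p) {P : ℤ} (hP : P ≠ 0) : ∃ (u : ℕ) (r : ℤ), P = p^u*r ∧ ¬ p ∣ r := by
  have hf : FiniteMultiplicity p P := FiniteMultiplicity.of_prime_left hp hP
  obtain ⟨r, h1, h2⟩ := hf.exists_eq_pow_mul_and_not_dvd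
  exact ⟨_, r, h1, h2⟩

lemma le_of_pow_dvd {p : ℤ} (hp : Prime p) {a b : ℕ} {r : ℤ} (hr : ¬ p ∣ r) (h : p^a ∣ p^b*r) : a ≤ b := by
  by_contra hab
  push Not at hab
  obtain ⟨c, rfl⟩ := Nat.exists_eq_add_of_lt hab
  have h' : p^(b+(c+1)) ∣ p^b*r*1 := by rw [mul_one]; exact h
  have h1 : p^(c+1) ∣ (1:ℤ) := pow_dvd_cancel hp hr h'
  exact hp.not_isUnit (isUnit_of_dvd_one ((dvd_pow_self p (by omega)).trans h1))

lemma dich_B {p : ℤ} {j k : ℕ} {D X X' y y' z' N : ℤ} (hp : Prime p) 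
    (hN : (p^j*y)^2 + D*X^2 = N) (hN' : (p^j*y')^2 + D*X'^2 = N) (hq : p^k ∣ N)
    (hy : ¬ p ∣ y) (hz' : D*X'^2 = p^(2*j)*z') (h0 : ¬ p ∣ z') :
    p^(2*k) ∣ 4*D*((p^j*y)*X'-X*(p^j*y'))^2 ∨ p^(2*k) ∣ 4*D*((p^j*y)*X'+X*(p^j*y'))^2 := by
  by_contra hcon
  push Not at hcon
  obtain ⟨c1, c2⟩ := hcon
  have n1 : 4*D*((p^j*y)*X'-X*(p^j*y'))^2 ≠ 0 := fun h => c1 (h ▸ dvd_zero _)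
  have n2 : 4*D*((p^j*y)*X'+X*(p^j*y'))^2 ≠ 0 := fun h => c2 (h ▸ dvd_zero _)
  obtain ⟨u, r, e1, hr⟩ := exists_fac hp n1
  obtain ⟨v, s, e2, hs⟩ := exists_fac hp n2
  obtain ⟨e, t, e3, ht⟩ := exists_fac hp (show (4:ℤ) ≠ 0 by norm_num)
  have hu : u < 2*k := by
    by_contra h; push Not at h
    exact c1 (e1 ▸ (pow_dvd_pow p h).mul_right _)
  have hv : v < 2*k := by
    by_contra h; push Not at h
    exact c2 (e2 ▸ (pow_dvd_pow p h).mul_right _)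
  have hprod : p^(2*e+2*k+4*j) ∣ p^(u+v)*(r*s) := by
    have : p^(u+v)*(r*s) = 4^2*N^2*(p^(4*j)*(y^2-y'^2)^2) := by
      have h1 : p^(u+v)*(r*s) = (4*D*((p^j*y)*X'-X*(p^j*y'))^2) * (4*D*((p^j*y)*X'+X*(p^j*y'))^2) := by
        rw [e1, e2]; ring
      have h2 : D*((p^j*y)*X'-X*(p^j*y'))*((p^j*y)*X'+X*(p^j*y')) = N*((p^j*y)^2-(p^j*y')^2) := by
        linear_combination (p^j*y)^2 * hN' - (p^j*y')^2*hN
      have h3 : p^(4*j) = (p^j)^4 := by rw [← pow_mul]; ring_nf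
      rw [h1, h3]
      linear_combination 16*((D*((p^j*y)*X'-X*(p^j*y'))*((p^j*y)*X'+X*(p^j*y'))) + N*((p^j*y)^2-(p^j*y')^2)) * h2
    rw [this, pow_add, pow_add]
    refine mul_dvd_mul (mul_dvd_mul ?_ ?_) (dvd_mul_right _ _)
    · rw [mul_comm 2 e, pow_mul]
      exact pow_dvd_pow_of_dvd (Dvd.intro t e3.symm) 2
    · rw [mul_comm 2 k, pow_mul]
      exact pow_dvd_pow_of_dvd hq 2
  have hle := le_of_pow_dvd hp (fun h => (hp.dvd_or_dvd h).elim hr hs) hprod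
  have d1 : p^(2*e+4*j+1) ∣ 4*D*((p^j*y)*X'-X*(p^j*y'))^2 := by
    rw [e1]; exact (pow_dvd_pow p (by omega)).mul_right _
  have d2 : p^(2*e+4*j+1) ∣ 4*D*((p^j*y)*X'+X*(p^j*y'))^2 := by
    rw [e2]; exact (pow_dvd_pow p (by omega)).mul_right _
  have d3 : p^(2*e+4*j+1) ∣ 4*D*((p^j*y)*X'-X*(p^j*y'))*((p^j*y)*X'+X*(p^j*y')) := by
    apply (Int.pow_dvd_pow_iff (n := 2) (by norm_num)).1
    have := mul_dvd_mul d1 d2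
    rw [← sq] at this
    have e2 : (4*D*((p^j*y)*X'-X*(p^j*y'))*((p^j*y)*X'+X*(p^j*y')))^2 = (4*D*((p^j*y)*X'-X*(p^j*y'))^2) * (4*D*((p^j*y)*X'+X*(p^j*y'))^2) := by ring
    rw [e2]; exact this
  have d4 := dvd_add (dvd_add d1 d2) (d3.mul_left 2)
  have e4 : 4*D*((p^j*y)*X'-X*(p^j*y'))^2 + 4*D*((p^j*y)*X'+X*(p^j*y'))^2 + 2*(4*D*((p^j*y)*X'-X*(p^j*y'))*((p^j*y)*X'+X*(p^j*y'))) = p^(2*e+4*j)*(t^2*(y^2*z')) := by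
    have h3 : p^(2*e+4*j) = (p^e)^2*(p^j)^4 := by rw [← pow_mul, ← pow_mul, ← pow_add]; ring_nf
    have h4 : p^(2*j) = (p^j)^2 := by rw [← pow_mul]; ring_nf
    rw [h4] at hz'
    rw [h3]
    linear_combination 16*(p^j*y)^2*hz' + (4 + p^e*t)*(p^j)^4*y^2*z'*e3
  rw [e4] at d4
  have hn : ¬ p ∣ t^2*(y^2*z') := by
    intro h
    rcases hp.dvd_or_dvd h with h | h
    · exact ht (hp.dvd_of_dvd_pow h)
    · rcases hp.dvd_or_dvd h with h | h
      · exact hy (hp.dvd_of_dvd_pow h)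
      · exact h0 h
  have := le_of_pow_dvd hp hn d4
  omega

/-- Local statement: for three solutions with the same truncated `p`-valuations of `Y`. -/
lemma local_all {p : ℤ} {k : ℕ} {D N : ℤ} (hp : Prime p) (hq : p^k ∣ N)
    {X Y X' Y' X0 Y0 : ℤ} (hN : Y^2 + D*X^2 = N) (hN' : Y'^2 + D*X'^2 = N)
    (hN0 : Y0^2 + D*X0^2 = N)
    (h : ∀ i ≤ k, (p^i ∣ Y ↔ p^i ∣ Y0)) (h' : ∀ i ≤ k, (p^i ∣ Y' ↔ p^i ∣ Y0))
    (hg : p^(2*k) ∣ 4*D*(Y*X0-X*Y0)^2 ↔ p^(2*k) ∣ 4*D*(Y'*X0-X'*Y0)^2) :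
    p^(2*k) ∣ 4*D*(Y*X'-X*Y')^2 := by
  have hm : (k+1)/2 ≤ k := by omega
  by_cases hA : p^((k+1)/2) ∣ Y0
  · have key : ∀ W : ℤ, p^((k+1)/2) ∣ W → p^k ∣ W^2 := by
      intro W hW
      refine (pow_dvd_pow p (show k ≤ (k+1)/2*2 by omega)).trans ?_
      rw [pow_mul]; exact pow_dvd_pow_of_dvd hW 2
    rw [mul_comm 2 k, pow_mul]
    exact caseA hN hN' hq (key _ ((h _ hm).2 hA)) (key _ ((h' _ hm).2 hA))
  · have hY0 : Y0 ≠ 0 := by rintro rfl; exact hA (dvd_zero _)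
    obtain ⟨j, y0, rfl, hy0⟩ := exists_fac hp hY0
    have hj : j < (k+1)/2 := by
      by_contra hj; push Not at hj
      exact hA ((pow_dvd_pow p hj).mul_right _)
    have ext : ∀ W : ℤ, (∀ i ≤ k, (p^i ∣ W ↔ p^i ∣ p^j*y0)) → ∃ w, W = p^j*w ∧ ¬ p ∣ w := by
      intro W hW
      obtain ⟨w, rfl⟩ := (hW j (by omega)).2 (dvd_mul_right _ _)
      refine ⟨w, rfl, fun hw => ?_⟩
      have h1 : p^(j+1) ∣ p^j*w := by rw [pow_succ]; exact mul_dvd_mul_left _ hw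
      have := le_of_pow_dvd hp hy0 ((hW (j+1) (by omega)).1 h1)
      omega
    obtain ⟨y, rfl, hy⟩ := ext Y h
    obtain ⟨y', rfl, hy'⟩ := ext Y' h'
    have hjk : 2*j < k := by omega
    obtain ⟨z0, hz0, hz0'⟩ := caseB_z hp hN0 hq hy0 hjk
    obtain ⟨z, hz, _⟩ := caseB_z hp hN hq hy hjk
    obtain ⟨z', hz', _⟩ := caseB_z hp hN' hq hy' hjk
    by_cases hgood : p^(2*k) ∣ 4*D*((p^j*y)*X0-X*(p^j*y0))^2
    · exact trans_B hp hz hz' hz0 hz0' hgood (hg.1 hgood)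
    · have g1 := (dich_B hp hN hN0 hq hy hz0 hz0').resolve_left hgood
      have g2 := (dich_B hp hN' hN0 hq hy' hz0 hz0').resolve_left (fun h => hgood (hg.2 h))
      have hz0n : D*(-X0)^2 = p^(2*j)*z0 := by rw [← hz0]; ring
      refine trans_B (Y0 := p^j*y0) hp hz hz' hz0n hz0' ?_ ?_
      · convert g1 using 1; ring
      · convert g2 using 1; ring

lemma fiber_dvd {N : ℕ} (hN0 : N ≠ 0) {D : ℤ}
    {X Y X' Y' X0 Y0 : ℤ} (hN : Y^2 + D*X^2 = N) (hN' : Y'^2 + D*X'^2 = N)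
    (hN0' : Y0^2 + D*X0^2 = N)
    (h : Int.gcd N Y = Int.gcd N Y0) (h' : Int.gcd N Y' = Int.gcd N Y0)
    (hg : ∀ p ∈ N.primeFactors, ((p:ℤ)^(2*N.factorization p) ∣ 4*D*(Y*X0-X*Y0)^2 ↔
       (p:ℤ)^(2*N.factorization p) ∣ 4*D*(Y'*X0-X'*Y0)^2)) :
    (N:ℤ)^2 ∣ 4*D*(Y*X'-X*Y')^2 := by
  have key : N^2 ∣ (4*D*(Y*X'-X*Y')^2).natAbs := by
    have e : N^2 = ∏ p ∈ N.primeFactors, p^(2*N.factorization p) := by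
      conv_lhs => rw [← Nat.prod_factorization_pow_eq_self hN0]
      rw [Finsupp.prod, ← Finset.prod_pow]
      apply Finset.prod_congr rfl
      intro p _
      rw [← pow_mul, mul_comm]
    rw [e]
    apply Finset.prod_dvd_of_isRelPrime
    · intro a ha b hb hab
      have ha' := Nat.prime_of_mem_primeFactors ha
      have hb' := Nat.prime_of_mem_primeFactors hb
      exact Nat.coprime_iff_isRelPrime.1 (Nat.Coprime.pow _ _ ((Nat.coprime_primes ha' hb').2 hab))
    · intro p hp
      have hpp := Nat.prime_of_mem_primeFactors hp
      rw [← Int.natCast_dvd]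
      push_cast
      have hdvd : (p:ℤ)^(N.factorization p) ∣ (N:ℤ) := by
        exact_mod_cast Nat.ordProj_dvd N p
      have hgc : ∀ W W' : ℤ, Int.gcd N W = Int.gcd N W' → ∀ i ≤ N.factorization p,
          ((p:ℤ)^i ∣ W ↔ (p:ℤ)^i ∣ W') := by
        intro W W' hW i hi
        have hd : (p:ℤ)^i ∣ (N:ℤ) := (pow_dvd_pow _ hi).trans hdvd
        have aux : ∀ V : ℤ, (p:ℤ)^i ∣ V ↔ (p:ℤ)^i ∣ (Int.gcd N V : ℤ) := fun V =>
          ⟨fun h => Int.dvd_coe_gcd hd h, fun h => h.trans (Int.gcd_dvd_right _ _)⟩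
        rw [aux W, aux W', hW]
      exact local_all (Nat.prime_iff_prime_int.1 hpp) hdvd hN hN' hN0' (hgc _ _ h) (hgc _ _ h') (hg p hp)
  have := Int.natCast_dvd.2 key
  simpa using this

lemma fiber_inj {N : ℕ} (hN0 : N ≠ 0) {D : ℤ} (hD : 0 < D) (T : Finset (ℤ × ℤ)) (X' Y' : ℤ)
    (hN' : Y'^2 + D*X'^2 = N)
    (hT : ∀ q ∈ T, q.2^2 + D*q.1^2 = N ∧ (N:ℤ)^2 ∣ 4*D*(q.2*X'-q.1*Y')^2) : T.card ≤ 20 := by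
  classical
  let f : ℤ × ℤ → ℤ × Bool × Bool := fun q =>
    (4*D*(q.2*X'-q.1*Y')^2/(N:ℤ)^2, decide (0 ≤ q.2*X'-q.1*Y'), decide (0 ≤ q.2*Y' + D*q.1*X'))
  have hNpos : (0:ℤ) < (N:ℤ)^2 := by positivity
  have habs : ∀ a b : ℤ, a^2 = b^2 → (0 ≤ a ↔ 0 ≤ b) → a = b := by
    intro a b h h2
    rcases sq_eq_sq_iff_eq_or_eq_neg.1 h with h | h
    · exact h
    · subst h; by_cases hb : 0 ≤ b
      · have := h2.2 hb; omega
      · have : ¬ 0 ≤ -b := fun h => hb (h2.1 h)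
        omega
  have hcard : T.card ≤ ((Finset.Icc (0:ℤ) 4) ×ˢ (Finset.univ : Finset (Bool × Bool))).card := by
    apply Finset.card_le_card_of_injOn f
    · rintro ⟨X, Y⟩ hq
      obtain ⟨h1, h2⟩ := hT _ hq
      simp only at h1 h2
      simp only [f, Finset.coe_product, Finset.coe_univ, Set.mem_prod, Set.mem_univ, and_true, Finset.coe_Icc, Set.mem_Icc]
      constructor
      · positivity
      · have : 4*D*(Y*X'-X*Y')^2 ≤ 4*(N:ℤ)^2 := by
          have e : (Y*Y'+D*X*X')^2 + D*(Y*X'-X*Y')^2 = (N:ℤ)^2 := by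
            linear_combination (Y'^2+D*X'^2)*h1 + N*hN'
          nlinarith [sq_nonneg (Y*Y'+D*X*X')]
        calc _ ≤ 4*(N:ℤ)^2/(N:ℤ)^2 := Int.ediv_le_ediv hNpos this
          _ = 4 := Int.mul_ediv_cancel _ hNpos.ne'
    · rintro ⟨X, Y⟩ hq ⟨U, V⟩ hq2 hf
      obtain ⟨h1, h2⟩ := hT _ hq
      obtain ⟨h3, h4⟩ := hT _ hq2
      simp only [f, Prod.mk.injEq, decide_eq_decide] at h1 h2 h3 h4 hf
      obtain ⟨f1, f2, f3⟩ := hf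
      have g1 := (Int.ediv_left_inj h2 h4).1 f1
      have hb2 : (Y*X'-X*Y')^2 = (V*X'-U*Y')^2 :=
        mul_left_cancel₀ (show 4*D ≠ 0 by positivity) g1
      have hb := habs _ _ hb2 f2
      have e : (Y*Y'+D*X*X')^2 + D*(Y*X'-X*Y')^2 = (N:ℤ)^2 := by
        linear_combination (Y'^2+D*X'^2)*h1 + N*hN'
      have e' : (V*Y'+D*U*X')^2 + D*(V*X'-U*Y')^2 = (N:ℤ)^2 := by
        linear_combination (Y'^2+D*X'^2)*h3 + N*hN'
      have ha := habs _ _ (show (Y*Y'+D*X*X')^2 = (V*Y'+D*U*X')^2 by rw [hb2] at e; linarith) f3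
      have hNz : (N:ℤ) ≠ 0 := by exact_mod_cast hN0
      have r1 : Y = V := mul_left_cancel₀ hNz (by
        linear_combination Y'*ha + D*X'*hb - (Y-V)*hN')
      have r2 : X = U := mul_left_cancel₀ hNz (by
        linear_combination X'*ha - Y'*hb - (X-U)*hN')
      rw [r1, r2]
  refine hcard.trans ?_
  simp

lemma two_pow_le_card_divisors {N : ℕ} (hN : N ≠ 0) : 2^N.primeFactors.card ≤ N.divisors.card := by
  rw [Nat.card_divisors hN, ← Finset.prod_const]
  apply Finset.prod_le_prod'
  intro p hp
  have := (Nat.prime_of_mem_primeFactors hp).factorization_pos_of_dvd hN (Nat.dvd_of_mem_primeFactors hp)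
  omega

theorem solcount {N : ℕ} (hN0 : N ≠ 0) {D : ℤ} (hD : 0 < D) (S : Finset (ℤ × ℤ))
    (hS : ∀ q ∈ S, q.2^2 + D*q.1^2 = N) : S.card ≤ 20 * N.divisors.card^2 := by
  classical
  have hrep : ∀ g : ℕ, ∃ ρ : ℤ × ℤ, (∃ q ∈ S, Int.gcd N q.2 = g) → ρ ∈ S ∧ Int.gcd N ρ.2 = g := by
    intro g
    by_cases h : ∃ q ∈ S, Int.gcd N q.2 = g
    · obtain ⟨q, hq⟩ := h; exact ⟨q, fun _ => hq⟩
    · exact ⟨0, fun h' => absurd h' h⟩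
  choose ρ hρ using hrep
  let f : ℤ × ℤ → ℕ × Finset ℕ := fun q => (Int.gcd N q.2, N.primeFactors.filter (fun p =>
    (p:ℤ)^(2*N.factorization p) ∣ 4*D*(q.2*(ρ (Int.gcd N q.2)).1-q.1*(ρ (Int.gcd N q.2)).2)^2))
  have h1 : S.card ≤ 20 * (S.image f).card := by
    apply Finset.card_le_mul_card_image
    intro c hc
    obtain ⟨r, hr, rfl⟩ := Finset.mem_image.1 hc
    apply fiber_inj hN0 hD _ r.1 r.2 (hS r hr)
    intro q hq
    rw [Finset.mem_filter] at hq
    obtain ⟨hq, hqr⟩ := hq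
    refine ⟨hS q hq, ?_⟩
    simp only [f, Prod.mk.injEq] at hqr
    obtain ⟨g1, g2⟩ := hqr
    rw [g1] at g2
    obtain ⟨hρS, hρg⟩ := hρ (Int.gcd N r.2) ⟨r, hr, rfl⟩
    refine fiber_dvd hN0 (hS q hq) (hS r hr) (hS _ hρS) (g1.trans hρg.symm) hρg.symm ?_
    intro p hp
    have := Finset.ext_iff.1 g2 p
    simpa [Finset.mem_filter, hp, -Nat.mem_primeFactors] using this
  have h2 : (S.image f).card ≤ (N.divisors ×ˢ N.primeFactors.powerset).card := by
    apply Finset.card_le_card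
    intro c hc
    obtain ⟨r, hr, rfl⟩ := Finset.mem_image.1 hc
    simp only [f, Finset.mem_product, Nat.mem_divisors, Finset.mem_powerset]
    refine ⟨⟨?_, hN0⟩, Finset.filter_subset _ _⟩
    exact_mod_cast Int.gcd_dvd_left (N:ℤ) r.2
  rw [Finset.card_product, Finset.card_powerset] at h2
  have h3 := two_pow_le_card_divisors hN0
  calc S.card ≤ 20 * (S.image f).card := h1
    _ ≤ 20 * (N.divisors.card * N.divisors.card) := by
        gcongr; exact h2.trans (Nat.mul_le_mul_left _ h3)
    _ = _ := by ring

lemma card_div_bound {N : ℕ} (hN : N ≠ 0) {ε : ℝ} (hε : 0 < ε) :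
    (N.divisors.card : ℝ) ≤ (N:ℝ)^ε * (1 + 1/(ε*Real.log 2))^((2:ℝ)^(1/ε)) := by
  have hl2 : 0 < Real.log 2 := Real.log_pos (by norm_num)
  set B : ℝ := 1 + 1/(ε*Real.log 2) with hB
  have hB1 : 1 ≤ B := by rw [hB]; have : 0 ≤ 1/(ε*Real.log 2) := by positivity
                         linarith
  have hBpos : 0 < B := by linarith
  rw [Nat.card_divisors hN]
  have hNe : (N:ℝ)^ε = ∏ p ∈ N.primeFactors, ((p:ℝ)^ε)^(N.factorization p) := by
    conv_lhs => rw [← Nat.prod_factorization_pow_eq_self hN]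
    rw [Finsupp.prod]
    push_cast
    rw [← Real.finsetProd_rpow _ _ (fun i _ => by positivity)]
    apply Finset.prod_congr rfl
    intro p _
    rw [← Real.rpow_natCast, ← Real.rpow_natCast, ← Real.rpow_mul (by positivity), ← Real.rpow_mul (by positivity), mul_comm]
  have hstep : ((∏ x ∈ N.primeFactors, (N.factorization x + 1) : ℕ):ℝ) ≤
      ∏ p ∈ N.primeFactors, (((p:ℝ)^ε)^(N.factorization p) * (if (p:ℝ) < (2:ℝ)^(1/ε) then B else 1)) := by
    push_cast
    apply Finset.prod_le_prod
    · intro i _; positivity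
    · intro p hp
      have hpp := Nat.prime_of_mem_primeFactors hp
      have hp2 : (2:ℝ) ≤ p := by exact_mod_cast hpp.two_le
      set k := N.factorization p
      split_ifs with h
      · have h1 : (1 + k*(ε*Real.log 2)) ≤ ((p:ℝ)^ε)^k := by
          calc 1 + k*(ε*Real.log 2) ≤ Real.exp (k*(ε*Real.log 2)) := by
                linarith [Real.add_one_le_exp (k*(ε*Real.log 2))]
            _ = ((2:ℝ)^ε)^k := by
                rw [Real.rpow_def_of_pos (by norm_num), ← Real.exp_nat_mul]; ring_nf
            _ ≤ _ := by gcongr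
        have h2 : (k:ℝ) + 1 ≤ (1 + k*(ε*Real.log 2)) * B := by
          have : (1 + k*(ε*Real.log 2)) * B = 1 + k*(ε*Real.log 2) + 1/(ε*Real.log 2) + k := by
            rw [hB]; field_simp; ring
          rw [this]
          have : 0 ≤ k*(ε*Real.log 2) + 1/(ε*Real.log 2) := by positivity
          linarith
        exact h2.trans (by gcongr)
      · push Not at h
        rw [mul_one]
        have h1 : (2:ℝ) ≤ (p:ℝ)^ε := by
          calc (2:ℝ) = ((2:ℝ)^(1/ε))^ε := by
                rw [← Real.rpow_mul (by norm_num)]; field_simp; simp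
            _ ≤ _ := by gcongr
        calc (k:ℝ) + 1 ≤ 2^k := by exact_mod_cast Nat.lt_two_pow_self
          _ ≤ _ := by gcongr
  refine hstep.trans ?_
  rw [Finset.prod_mul_distrib, ← hNe]
  gcongr
  rw [Finset.prod_ite, Finset.prod_const, Finset.prod_const_one, mul_one, ← Real.rpow_natCast]
  apply Real.rpow_le_rpow_of_exponent_le hB1
  have hM : 0 ≤ (2:ℝ)^(1/ε) := by positivity
  have : (N.primeFactors.filter (fun p : ℕ => (p:ℝ) < (2:ℝ)^(1/ε))).card ≤ (Finset.Icc 1 ⌊(2:ℝ)^(1/ε)⌋₊).card := by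
    apply Finset.card_le_card
    intro p hp
    rw [Finset.mem_filter] at hp
    rw [Finset.mem_Icc]
    exact ⟨(Nat.prime_of_mem_primeFactors hp.1).one_le, Nat.le_floor hp.2.le⟩
  rw [Nat.card_Icc] at this
  calc _ ≤ ((⌊(2:ℝ)^(1/ε)⌋₊ : ℕ):ℝ) := by exact_mod_cast this
    _ ≤ _ := Nat.floor_le hM

lemma loglog_pos {n : ℕ} (hn : 3 ≤ n) : 1 < Real.log n ∧ 0 < Real.log (Real.log n) := by
  have h1 : 1 < Real.log n := by
    rw [Real.lt_log_iff_exp_lt (by positivity)]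
    have : (3:ℝ) ≤ n := by exact_mod_cast hn
    linarith [Real.exp_one_lt_d9]
  exact ⟨h1, Real.log_pos h1⟩

lemma card_div_bound' {N n K : ℕ} (hN : N ≠ 0) (hn : 3 ≤ n) (hNn : N ≤ n^K) :
    (N.divisors.card : ℝ) ≤ (n:ℝ)^((2*K+32)/Real.log (Real.log n)) := by
  obtain ⟨hl, hll⟩ := loglog_pos hn
  set l := Real.log n with hldef
  set lam := Real.log l with hlam
  have hlpos : 0 < l := by linarith
  have h2a := Real.log_two_gt_d9
  have h2b := Real.log_two_lt_d9
  have hnpos : (0:ℝ) < n := by positivity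
  have hε : 0 < 2*Real.log 2/lam := by positivity
  refine (card_div_bound hN hε).trans ?_
  have e1 : (2:ℝ)^(1/(2*Real.log 2/lam)) = l^(1/2:ℝ) := by
    rw [Real.rpow_def_of_pos (by norm_num), Real.rpow_def_of_pos hlpos]
    congr 1; rw [← hlam]; field_simp
  have e2 : 1 + 1/(2*Real.log 2/lam*Real.log 2) ≤ Real.exp (2*lam) := by
    have : 1/(2*Real.log 2/lam*Real.log 2) ≤ 2*lam := by
      have : 1/(2*Real.log 2/lam*Real.log 2) = lam/(2*Real.log 2^2) := by field_simp
      rw [this, div_le_iff₀ (by positivity)]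
      have hsq : 0.48 < Real.log 2^2 := by nlinarith
      nlinarith
    linarith [Real.add_one_le_exp (2*lam)]
  have e3 : lam ≤ 4*l^(1/4:ℝ) := by
    have := Real.log_le_rpow_div hlpos.le (show (0:ℝ) < 1/4 by norm_num)
    rw [← hlam] at this; linarith
  have e4 : 2*lam*l^(1/2:ℝ) ≤ l*(32/lam) := by
    have h4 : (l^(1/4:ℝ))^2 = l^(1/2:ℝ) := by
      rw [← Real.rpow_natCast, ← Real.rpow_mul hlpos.le]; norm_num
    have h5 : l^(1/2:ℝ)*l^(1/2:ℝ) = l := by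
      rw [← Real.rpow_add hlpos]; norm_num
    have h6 : lam^2 ≤ 16*l^(1/2:ℝ) := by
      rw [← h4]; nlinarith
    rw [← mul_div_assoc, le_div_iff₀ hll]
    have : 0 ≤ l^(1/2:ℝ) := by positivity
    nlinarith
  rw [e1]
  have f1 : (N:ℝ)^(2*Real.log 2/lam) ≤ (n:ℝ)^(2*K/lam) := by
    calc (N:ℝ)^(2*Real.log 2/lam) ≤ ((n:ℝ)^(K:ℝ))^(2*Real.log 2/lam) := by
          gcongr; rw [Real.rpow_natCast]; exact_mod_cast hNn
      _ = (n:ℝ)^(K*(2*Real.log 2/lam)) := by rw [← Real.rpow_mul hnpos.le]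
      _ ≤ _ := by
          apply Real.rpow_le_rpow_of_exponent_le
          · exact_mod_cast (by omega : 1 ≤ n)
          · rw [← mul_div_assoc]
            apply div_le_div_of_nonneg_right _ hll.le
            have : (0:ℝ) ≤ K := by positivity
            nlinarith
  have f2 : (1 + 1/(2*Real.log 2/lam*Real.log 2))^(l^(1/2:ℝ)) ≤ (n:ℝ)^(32/lam) := by
    calc _ ≤ (Real.exp (2*lam))^(l^(1/2:ℝ)) := by gcongr
      _ = Real.exp (2*lam*l^(1/2:ℝ)) := by rw [← Real.exp_mul]
      _ ≤ Real.exp (l*(32/lam)) := by gcongr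
      _ = _ := by rw [Real.rpow_def_of_pos hnpos]
  rw [add_div, Real.rpow_add hnpos]
  gcongr

/-- twice the signed area of the triangle -/
def ell {R : Type*} [CommRing R] (u v ui vi uj vj : R) : R := (u-ui)*(vj-vi)-(v-vi)*(uj-ui)

lemma half_angle {u v : ℝ} (h : u^2+v^2=1) : ∃ c s : ℝ, c^2+s^2=1 ∧ u = c^2-s^2 ∧ v = 2*c*s := by
  by_cases hu : u = -1
  · refine ⟨0, 1, by norm_num, by rw [hu]; norm_num, ?_⟩
    subst hu
    have : v^2 = 0 := by linarith
    simpa using this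
  · have hu1 : 0 < 1 + u := by
      rcases lt_trichotomy (1+u) 0 with h1 | h1 | h1
      · nlinarith [sq_nonneg v]
      · exact absurd (by linarith) hu
      · exact h1
    have hc : 0 < (1+u)/2 := by linarith
    set c := Real.sqrt ((1+u)/2) with hcdef
    have hc2 : c^2 = (1+u)/2 := Real.sq_sqrt hc.le
    have hcp : 0 < c := Real.sqrt_pos.2 hc
    have hs2 : (v/(2*c))^2 = (1-u)/2 := by
      rw [div_pow, mul_pow, hc2]
      field_simp
      linarith
    refine ⟨c, v/(2*c), by rw [hc2, hs2]; ring, by rw [hc2, hs2]; ring, by field_simp⟩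

lemma ell_half {c s ci si cj sj : ℝ} (h : c^2+s^2=1) (hi : ci^2+si^2=1) (hj : cj^2+sj^2=1) :
    ell (c^2-s^2) (2*c*s) (ci^2-si^2) (2*ci*si) (cj^2-sj^2) (2*cj*sj) =
      4*(s*ci-c*si)*(s*cj-c*sj)*(si*cj-ci*sj) := by
  have h1 : ell (c^2-s^2) (2*c*s) (ci^2-si^2) (2*ci*si) (cj^2-sj^2) (2*cj*sj) =
    (c^2-s^2)*((2*cj*sj)*1 - (2*ci*si)*1) - (2*c*s)*((cj^2-sj^2)*1-(ci^2-si^2)*1)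
      - 1*((ci^2-si^2)*(2*cj*sj) - (2*ci*si)*(cj^2-sj^2)) := by unfold ell; ring
  have h2 : (c^2-s^2)*((2*cj*sj)*1 - (2*ci*si)*1) - (2*c*s)*((cj^2-sj^2)*1-(ci^2-si^2)*1)
      - 1*((ci^2-si^2)*(2*cj*sj) - (2*ci*si)*(cj^2-sj^2)) =
      (c^2-s^2)*((2*cj*sj)*(ci^2+si^2) - (2*ci*si)*(cj^2+sj^2)) - (2*c*s)*((cj^2-sj^2)*(ci^2+si^2)-(ci^2-si^2)*(cj^2+sj^2))
      - (c^2+s^2)*((ci^2-si^2)*(2*cj*sj) - (2*ci*si)*(cj^2-sj^2)) := by rw [h, hi, hj]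
  rw [h1, h2]; ring

lemma half_ne {c s ci si : ℝ} (h : c^2+s^2=1) (hi : ci^2+si^2=1)
    (hne : (c^2-s^2, 2*c*s) ≠ (ci^2-si^2, 2*ci*si)) : s*ci-c*si ≠ 0 := by
  intro h0
  apply hne
  have hc : c = ci*(c*ci+s*si) := by linear_combination -c*hi - si*h0
  have hs : s = si*(c*ci+s*si) := by linear_combination -s*hi + ci*h0
  have hl : (c*ci+s*si)^2 = 1 := by
    linear_combination hi + (ci^2+si^2)*h - (s*ci-c*si)*h0
  ext
  · show c^2-s^2 = ci^2-si^2
    calc c^2-s^2 = (ci*(c*ci+s*si))^2 - (si*(c*ci+s*si))^2 := by rw [← hc, ← hs]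
      _ = (ci^2-si^2)*(c*ci+s*si)^2 := by ring
      _ = _ := by rw [hl, mul_one]
  · show 2*c*s = 2*ci*si
    calc 2*c*s = 2*(ci*(c*ci+s*si))*(si*(c*ci+s*si)) := by rw [← hc, ← hs]
      _ = (2*ci*si)*(c*ci+s*si)^2 := by ring
      _ = _ := by rw [hl, mul_one]

lemma ell_ne {u v ui vi uj vj : ℝ} (h : u^2+v^2=1) (hi : ui^2+vi^2=1) (hj : uj^2+vj^2=1)
    (h1 : (u,v) ≠ (ui,vi)) (h2 : (u,v) ≠ (uj,vj)) (h3 : (ui,vi) ≠ (uj,vj)) :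
    ell u v ui vi uj vj ≠ 0 := by
  obtain ⟨c, s, e, rfl, rfl⟩ := half_angle h
  obtain ⟨ci, si, ei, rfl, rfl⟩ := half_angle hi
  obtain ⟨cj, sj, ej, rfl, rfl⟩ := half_angle hj
  rw [ell_half e ei ej]
  have := half_ne e ei h1
  have := half_ne e ej h2
  have := half_ne ei ej h3
  positivity

lemma ell_cross {u v u1 v1 u2 v2 u3 v3 u4 v4 u5 v5 : ℝ} (h : u^2+v^2=1) (h1 : u1^2+v1^2=1)
    (h2 : u2^2+v2^2=1) (h3 : u3^2+v3^2=1) (h4 : u4^2+v4^2=1) (h5 : u5^2+v5^2=1) :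
    ell u v u1 v1 u2 v2 * ell u v u3 v3 u4 v4 * (ell u5 v5 u1 v1 u3 v3 * ell u5 v5 u2 v2 u4 v4) =
    ell u v u1 v1 u3 v3 * ell u v u2 v2 u4 v4 * (ell u5 v5 u1 v1 u2 v2 * ell u5 v5 u3 v3 u4 v4) := by
  obtain ⟨c, s, e, rfl, rfl⟩ := half_angle h
  obtain ⟨c1, s1, e1, rfl, rfl⟩ := half_angle h1
  obtain ⟨c2, s2, e2, rfl, rfl⟩ := half_angle h2
  obtain ⟨c3, s3, e3, rfl, rfl⟩ := half_angle h3
  obtain ⟨c4, s4, e4, rfl, rfl⟩ := half_angle h4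
  obtain ⟨c5, s5, e5, rfl, rfl⟩ := half_angle h5
  rw [ell_half e e1 e2, ell_half e e3 e4, ell_half e5 e1 e3, ell_half e5 e2 e4,
    ell_half e e1 e3, ell_half e e2 e4, ell_half e5 e1 e2, ell_half e5 e3 e4]
  generalize s*c1-c*s1 = w1
  generalize s*c2-c*s2 = w2
  generalize s*c3-c*s3 = w3
  generalize s*c4-c*s4 = w4
  generalize s5*c1-c5*s1 = z1
  generalize s5*c2-c5*s2 = z2
  generalize s5*c3-c5*s3 = z3
  generalize s5*c4-c5*s4 = z4
  ring

lemma ell_affine (x0 y0 a b c d u v ui vi uj vj : ℝ) :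
    ell (x0+a*u+b*v) (y0+c*u+d*v) (x0+a*ui+b*vi) (y0+c*ui+d*vi) (x0+a*uj+b*vj) (y0+c*uj+d*vj) =
      (a*d-b*c) * ell u v ui vi uj vj := by unfold ell; ring

lemma quad_circle {A B C D E G x0 y0 a b c d : ℝ} (hδ : a*d-b*c ≠ 0)
    (h : ∀ u v : ℝ, u^2+v^2=1 → A*(x0+a*u+b*v)^2+B*(x0+a*u+b*v)*(y0+c*u+d*v)+C*(y0+c*u+d*v)^2
      +D*(x0+a*u+b*v)+E*(y0+c*u+d*v)+G = 0)
    (hne : ∃ u v : ℝ, A*(x0+a*u+b*v)^2+B*(x0+a*u+b*v)*(y0+c*u+d*v)+C*(y0+c*u+d*v)^2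
      +D*(x0+a*u+b*v)+E*(y0+c*u+d*v)+G ≠ 0) : 0 < 4*A*C-B^2 := by
  obtain ⟨k1, hk1⟩ : ∃ k1, k1 = A*a^2+B*a*c+C*c^2 := ⟨_, rfl⟩
  obtain ⟨k2, hk2⟩ : ∃ k2, k2 = A*b^2+B*b*d+C*d^2 := ⟨_, rfl⟩
  obtain ⟨m, hm⟩ : ∃ m, m = 2*A*a*b+B*(a*d+b*c)+2*C*c*d := ⟨_, rfl⟩
  obtain ⟨l1, hl1⟩ : ∃ m, m = 2*A*x0*a+B*(x0*c+y0*a)+2*C*y0*c+D*a+E*c := ⟨_, rfl⟩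
  obtain ⟨l2, hl2⟩ : ∃ m, m = 2*A*x0*b+B*(x0*d+y0*b)+2*C*y0*d+D*b+E*d := ⟨_, rfl⟩
  obtain ⟨g, hg⟩ : ∃ m, m = A*x0^2+B*x0*y0+C*y0^2+D*x0+E*y0+G := ⟨_, rfl⟩
  have key : ∀ u v : ℝ, A*(x0+a*u+b*v)^2+B*(x0+a*u+b*v)*(y0+c*u+d*v)+C*(y0+c*u+d*v)^2
      +D*(x0+a*u+b*v)+E*(y0+c*u+d*v)+G = k1*u^2+m*u*v+k2*v^2+l1*u+l2*v+g := by
    intro u v; rw [hk1, hk2, hm, hl1, hl2, hg]; ring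
  simp only [key] at h hne
  have h1 := h 1 0 (by norm_num)
  have h2 := h (-1) 0 (by norm_num)
  have h3 := h 0 1 (by norm_num)
  have h4 := h 0 (-1) (by norm_num)
  have h5 := h (3/5) (4/5) (by norm_num)
  have r1 : l1 = 0 := by linarith
  have r2 : l2 = 0 := by linarith
  have r3 : k1 = -g := by linarith
  have r4 : k2 = -g := by linarith
  have r5 : m = 0 := by rw [r1, r2, r3, r4] at h5; linarith
  have hg0 : g ≠ 0 := by
    rintro rfl
    obtain ⟨u, v, huv⟩ := hne
    apply huv; rw [r1, r2, r3, r4, r5]; ring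
  have id : (4*A*C-B^2)*(a*d-b*c)^2 = 4*k1*k2-m^2 := by rw [hk1, hk2, hm]; ring
  rw [r3, r4, r5] at id
  have hp : 0 < (4*A*C-B^2)*(a*d-b*c)^2 := by rw [id]; nlinarith [sq_pos_of_ne_zero hg0]
  exact pos_of_mul_pos_left hp (sq_nonneg _)

lemma abs_mul_le' {x y M M' : ℤ} (hx : |x| ≤ M) (hy : |y| ≤ M') : |x*y| ≤ M*M' := by
  rw [abs_mul]; exact mul_le_mul hx hy (abs_nonneg _) ((abs_nonneg _).trans hx)
lemma abs_add_le' {x y M M' : ℤ} (hx : |x| ≤ M) (hy : |y| ≤ M') : |x+y| ≤ M+M' :=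
  (abs_add_le x y).trans (add_le_add hx hy)
lemma abs_sub_le' {x y M M' : ℤ} (hx : |x| ≤ M) (hy : |y| ≤ M') : |x-y| ≤ M+M' :=
  (abs_sub x y).trans (add_le_add hx hy)

lemma conic_exists {n : ℕ} (hn : 3 ≤ n) {x0 y0 a b c d : ℝ} (hδ : a*d-b*c ≠ 0)
    (x y : Fin 5 → ℤ) (hx : ∀ i, 1 ≤ x i ∧ x i ≤ n) (hy : ∀ i, 1 ≤ y i ∧ y i ≤ n)
    (u v : Fin 5 → ℝ) (huv : ∀ i, u i^2+v i^2=1)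
    (hxu : ∀ i, (x i : ℝ) = x0+a*u i+b*v i) (hyu : ∀ i, (y i : ℝ) = y0+c*u i+d*v i)
    (hinj : ∀ i j, i ≠ j → (u i, v i) ≠ (u j, v j)) :
    ∃ A B C D E G : ℤ, |A| ≤ n^14 ∧ |B| ≤ n^14 ∧ |C| ≤ n^14 ∧ |D| ≤ n^14 ∧ |E| ≤ n^14 ∧ |G| ≤ n^14 ∧
      0 < 4*A*C-B^2 ∧ ∀ u v : ℝ, u^2+v^2=1 →
       A*(x0+a*u+b*v)^2+B*(x0+a*u+b*v)*(y0+c*u+d*v)+C*(y0+c*u+d*v)^2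
      +D*(x0+a*u+b*v)+E*(y0+c*u+d*v)+G = 0 := by
  have hn' : (3:ℤ) ≤ n := by exact_mod_cast hn
  -- line coefficients
  let α : Fin 5 → Fin 5 → ℤ := fun i j => y j - y i
  let β : Fin 5 → Fin 5 → ℤ := fun i j => -(x j - x i)
  let γ : Fin 5 → Fin 5 → ℤ := fun i j => y i * (x j - x i) - x i*(y j - y i)
  let l : Fin 5 → Fin 5 → ℤ := fun i j => ell (x 4) (y 4) (x i) (y i) (x j) (y j)
  have hpow : 2*(n:ℤ)^2 ≤ n^3 := by nlinarith [sq_nonneg (n:ℤ)]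
  have hpow1 : (n:ℤ) ≤ n^3 := by nlinarith [sq_nonneg (n:ℤ)]
  have dx : ∀ i j, |x j - x i| ≤ (n:ℤ) := fun i j => by
    rw [abs_le]; constructor <;> linarith [hx i, hx j, (hx i).1, (hx i).2, (hx j).1, (hx j).2]
  have dy : ∀ i j, |y j - y i| ≤ (n:ℤ) := fun i j => by
    rw [abs_le]; constructor <;> linarith [(hy i).1, (hy i).2, (hy j).1, (hy j).2]
  have ax : ∀ i, |x i| ≤ (n:ℤ) := fun i => by
    rw [abs_le]; constructor <;> linarith [(hx i).1, (hx i).2]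
  have ay : ∀ i, |y i| ≤ (n:ℤ) := fun i => by
    rw [abs_le]; constructor <;> linarith [(hy i).1, (hy i).2]
  have bα : ∀ i j, |α i j| ≤ (n:ℤ)^3 := fun i j => (dy i j).trans hpow1
  have bβ : ∀ i j, |β i j| ≤ (n:ℤ)^3 := fun i j => by
    simp only [β, abs_neg]; exact (dx i j).trans hpow1
  have bγ : ∀ i j, |γ i j| ≤ (n:ℤ)^3 := fun i j =>
    (abs_sub_le' (abs_mul_le' (ay i) (dx i j)) (abs_mul_le' (ax i) (dy i j))).trans (by nlinarith)
  have bl : ∀ i j, |l i j| ≤ (n:ℤ)^3 := fun i j =>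
    (abs_sub_le' (abs_mul_le' (dx i 4) (dy i j)) (abs_mul_le' (dy i 4) (dx i j))).trans (by nlinarith)
  have lin : ∀ i j (X Y : ℝ), ell X Y (x i:ℝ) (y i) (x j) (y j) = α i j * X + β i j * Y + γ i j := by
    intro i j X Y; simp only [ell, α, β, γ]; push_cast; ring
  have lcast : ∀ i j, ((l i j : ℤ):ℝ) = ell (x 4:ℝ) (y 4) (x i) (y i) (x j) (y j) := by
    intro i j; simp only [ell, l]; push_cast; ring
  obtain ⟨s, hs⟩ : ∃ s, s = l 0 2 * l 1 3 := ⟨_, rfl⟩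
  obtain ⟨t, ht⟩ : ∃ t, t = l 0 1 * l 2 3 := ⟨_, rfl⟩
  have bs : |s| ≤ (n:ℤ)^3*n^3 := hs ▸ abs_mul_le' (bl _ _) (bl _ _)
  have bt : |t| ≤ (n:ℤ)^3*n^3 := ht ▸ abs_mul_le' (bl _ _) (bl _ _)
  have hbig : 4*(n:ℤ)^12 ≤ n^14 := by
    have : (n:ℤ)^14 = n^2*n^12 := by ring
    rw [this]; gcongr; nlinarith
  have hp12 : (0:ℤ) ≤ (n:ℤ)^12 := by positivity
  have bnd1 : ∀ p q r w : ℤ, |p| ≤ (n:ℤ)^3 → |q| ≤ (n:ℤ)^3 → |r| ≤ (n:ℤ)^3 → |w| ≤ (n:ℤ)^3 →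
      |s*(p*q) - t*(r*w)| ≤ (n:ℤ)^14 := by
    intro p q r w hp hq hr hw
    refine (abs_sub_le' (abs_mul_le' bs (abs_mul_le' hp hq)) (abs_mul_le' bt (abs_mul_le' hr hw))).trans ?_
    ring_nf at hbig hp12 ⊢; linarith
  have bnd2 : ∀ p q r w p' q' r' w' : ℤ, |p| ≤ (n:ℤ)^3 → |q| ≤ (n:ℤ)^3 → |r| ≤ (n:ℤ)^3 → |w| ≤ (n:ℤ)^3 →
      |p'| ≤ (n:ℤ)^3 → |q'| ≤ (n:ℤ)^3 → |r'| ≤ (n:ℤ)^3 → |w'| ≤ (n:ℤ)^3 →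
      |s*(p*q+p'*q') - t*(r*w+r'*w')| ≤ (n:ℤ)^14 := by
    intro p q r w p' q' r' w' hp hq hr hw hp' hq' hr' hw'
    refine (abs_sub_le' (abs_mul_le' bs (abs_add_le' (abs_mul_le' hp hq) (abs_mul_le' hp' hq')))
      (abs_mul_le' bt (abs_add_le' (abs_mul_le' hr hw) (abs_mul_le' hr' hw')))).trans ?_
    ring_nf at hbig hp12 ⊢; linarith
  have hF : ∀ X Y : ℝ,
      ((s*(α 0 1*α 2 3) - t*(α 0 2*α 1 3) : ℤ):ℝ)*X^2
      + ((s*(α 0 1*β 2 3+β 0 1*α 2 3) - t*(α 0 2*β 1 3+β 0 2*α 1 3) : ℤ):ℝ)*X*Y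
      + ((s*(β 0 1*β 2 3) - t*(β 0 2*β 1 3) : ℤ):ℝ)*Y^2
      + ((s*(α 0 1*γ 2 3+γ 0 1*α 2 3) - t*(α 0 2*γ 1 3+γ 0 2*α 1 3) : ℤ):ℝ)*X
      + ((s*(β 0 1*γ 2 3+γ 0 1*β 2 3) - t*(β 0 2*γ 1 3+γ 0 2*β 1 3) : ℤ):ℝ)*Y
      + ((s*(γ 0 1*γ 2 3) - t*(γ 0 2*γ 1 3) : ℤ):ℝ)
      = ell X Y (x 0:ℝ) (y 0) (x 1) (y 1) * ell X Y (x 2:ℝ) (y 2) (x 3) (y 3) * s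
       - ell X Y (x 0:ℝ) (y 0) (x 2) (y 2) * ell X Y (x 1:ℝ) (y 1) (x 3) (y 3) * t := by
    intro X Y
    rw [lin, lin, lin, lin]
    generalize α 0 1 = a1
    generalize α 2 3 = a2
    generalize α 0 2 = a3
    generalize α 1 3 = a4
    generalize β 0 1 = b1
    generalize β 2 3 = b2
    generalize β 0 2 = b3
    generalize β 1 3 = b4
    generalize γ 0 1 = g1
    generalize γ 2 3 = g2
    generalize γ 0 2 = g3
    generalize γ 1 3 = g4
    push_cast
    ring
  have hF2 : ∀ U V : ℝ, ell (x0+a*U+b*V) (y0+c*U+d*V) (x 0:ℝ) (y 0) (x 1) (y 1) * ell (x0+a*U+b*V) (y0+c*U+d*V) (x 2:ℝ) (y 2) (x 3) (y 3) * s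
       - ell (x0+a*U+b*V) (y0+c*U+d*V) (x 0:ℝ) (y 0) (x 2) (y 2) * ell (x0+a*U+b*V) (y0+c*U+d*V) (x 1:ℝ) (y 1) (x 3) (y 3) * t
       = (a*d-b*c)^4 * (
    ell U V (u 0) (v 0) (u 1) (v 1) * ell U V (u 2) (v 2) (u 3) (v 3) * (ell (u 4) (v 4) (u 0) (v 0) (u 2) (v 2) * ell (u 4) (v 4) (u 1) (v 1) (u 3) (v 3)) -
    ell U V (u 0) (v 0) (u 2) (v 2) * ell U V (u 1) (v 1) (u 3) (v 3) * (ell (u 4) (v 4) (u 0) (v 0) (u 1) (v 1) * ell (u 4) (v 4) (u 2) (v 2) (u 3) (v 3))) := by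
    intro U V
    rw [hs, ht]
    push_cast
    simp only [lcast, hxu, hyu, ell_affine]
    ring
  have hvan : ∀ U V : ℝ, U^2+V^2=1 → _ := fun U V hUV =>
    ((hF (x0+a*U+b*V) (y0+c*U+d*V)).trans (hF2 U V)).trans
      (by rw [ell_cross hUV (huv 0) (huv 1) (huv 2) (huv 3) (huv 4), sub_self, mul_zero])
  refine ⟨_, _, _, _, _, _, bnd1 _ _ _ _ (bα 0 1) (bα 2 3) (bα 0 2) (bα 1 3),
    bnd2 _ _ _ _ _ _ _ _ (bα 0 1) (bβ 2 3) (bα 0 2) (bβ 1 3) (bβ 0 1) (bα 2 3) (bβ 0 2) (bα 1 3),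
    bnd1 _ _ _ _ (bβ 0 1) (bβ 2 3) (bβ 0 2) (bβ 1 3),
    bnd2 _ _ _ _ _ _ _ _ (bα 0 1) (bγ 2 3) (bα 0 2) (bγ 1 3) (bγ 0 1) (bα 2 3) (bγ 0 2) (bα 1 3),
    bnd2 _ _ _ _ _ _ _ _ (bβ 0 1) (bγ 2 3) (bβ 0 2) (bγ 1 3) (bγ 0 1) (bβ 2 3) (bγ 0 2) (bβ 1 3),
    bnd1 _ _ _ _ (bγ 0 1) (bγ 2 3) (bγ 0 2) (bγ 1 3), ?_, hvan⟩
  have hq := quad_circle hδ hvan ⟨(u 0+u 1)/2, (v 0+v 1)/2, ?_⟩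
  · exact_mod_cast hq
  · rw [hF, hF2]
    have m1 : ell ((u 0+u 1)/2) ((v 0+v 1)/2) (u 0) (v 0) (u 1) (v 1) = 0 := by unfold ell; ring
    have m2 : ell ((u 0+u 1)/2) ((v 0+v 1)/2) (u 0) (v 0) (u 2) (v 2) = ell (u 1) (v 1) (u 0) (v 0) (u 2) (v 2)/2 := by unfold ell; ring
    have m3 : ell ((u 0+u 1)/2) ((v 0+v 1)/2) (u 1) (v 1) (u 3) (v 3) = ell (u 0) (v 0) (u 1) (v 1) (u 3) (v 3)/2 := by unfold ell; ring
    rw [m1, m2, m3]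
    have ne : ∀ i j k : Fin 5, i ≠ j → i ≠ k → j ≠ k → ell (u i) (v i) (u j) (v j) (u k) (v k) ≠ 0 :=
      fun i j k h1 h2 h3 => ell_ne (huv i) (huv j) (huv k) (hinj _ _ h1) (hinj _ _ h2) (hinj _ _ h3)
    have n1 := ne 1 0 2 (by decide) (by decide) (by decide)
    have n2 := ne 0 1 3 (by decide) (by decide) (by decide)
    have n3 := ne 4 0 1 (by decide) (by decide) (by decide)
    have n4 := ne 4 2 3 (by decide) (by decide) (by decide)
    rw [zero_mul, zero_mul, zero_sub]
    refine mul_ne_zero (pow_ne_zero _ hδ) (neg_ne_zero.2 ?_)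
    positivity

lemma quad_count {n : ℕ} (hn : 3 ≤ n) {A B C D E G : ℤ} (hA : |A| ≤ n^14) (hB : |B| ≤ n^14)
    (hC : |C| ≤ n^14) (hD : |D| ≤ n^14) (hE : |E| ≤ n^14) (hG : |G| ≤ n^14)
    (hpos : 0 < 4*A*C-B^2) (S : Finset (ℤ × ℤ)) (hcard : 2 ≤ S.card)
    (hS : ∀ q ∈ S, A*q.1^2+B*q.1*q.2+C*q.2^2+D*q.1+E*q.2+G = 0) :
    (S.card : ℝ) ≤ 20 * (n:ℝ)^((308:ℝ)/Real.log (Real.log n)) := by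
  have hA0 : A ≠ 0 := by rintro rfl; nlinarith [sq_nonneg B]
  obtain ⟨Δ, hΔ⟩ : ∃ Δ, Δ = 4*A*C-B^2 := ⟨_, rfl⟩
  obtain ⟨e, he⟩ : ∃ e, e = 2*(B*D)-4*(A*E) := ⟨_, rfl⟩
  obtain ⟨g, hg⟩ : ∃ g, g = D*D-4*(A*G) := ⟨_, rfl⟩
  rw [← hΔ] at hpos
  obtain ⟨M, hM⟩ : ∃ M : ℤ, M = e*e+4*(Δ*g) := ⟨_, rfl⟩
  let f : ℤ × ℤ → ℤ × ℤ := fun q => (2*(2*A*q.1+B*q.2+D), 2*Δ*q.2-e)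
  have hf : Function.Injective f := by
    rintro ⟨x, y⟩ ⟨x', y'⟩ h
    simp only [f, Prod.mk.injEq] at h
    obtain ⟨h1, h2⟩ := h
    have hy : y = y' := mul_left_cancel₀ (show 2*Δ ≠ 0 by positivity) (by linarith)
    subst hy
    have hx : x = x' := mul_left_cancel₀ (show 4*A ≠ 0 by positivity) (by linarith)
    rw [hx]
  have hsol : ∀ q ∈ S, (f q).2^2 + Δ*(f q).1^2 = M := by
    intro q hq
    have := hS q hq
    simp only [f]
    rw [hM, hg, he]
    have h1 : (2*A*q.1+B*q.2+D)^2 = -Δ*q.2^2 + (2*(B*D)-4*(A*E))*q.2 + (D*D-4*(A*G)) := by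
      rw [hΔ]; linear_combination 4*A*this
    linear_combination 4*Δ*h1
  have hMpos : 0 < M := by
    obtain ⟨q, hq, r, hr, hqr⟩ := Finset.one_lt_card.1 (show 1 < S.card by omega)
    have h1 := hsol q hq
    have h2 := hsol r hr
    have hM0 : 0 ≤ M := by rw [← h1]; positivity
    rcases hM0.lt_or_eq with h | h
    · exact h
    · exfalso
      have z : ∀ X Y : ℤ, Y^2+Δ*X^2 = 0 → X = 0 ∧ Y = 0 := by
        intro X Y hXY
        have hY : Y^2 = 0 := by nlinarith [sq_nonneg X, sq_nonneg Y, mul_nonneg hpos.le (sq_nonneg X)]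
        have hX : Δ*X^2 = 0 := by rw [hY] at hXY; linarith
        refine ⟨?_, by simpa using hY⟩
        rcases mul_eq_zero.1 hX with h | h
        · exact absurd h hpos.ne'
        · simpa using h
      rw [← h] at h1 h2
      apply hqr; apply hf
      have a1 := z _ _ h1
      have a2 := z _ _ h2
      ext
      · rw [a1.1, a2.1]
      · rw [a1.2, a2.2]
  obtain ⟨N, rfl⟩ := Int.eq_ofNat_of_zero_le hMpos.le
  have hN0 : N ≠ 0 := by rintro rfl; simp at hMpos
  have hNle : N ≤ n^61 := by
    have hn' : (3:ℤ) ≤ n := by exact_mod_cast hn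
    have b4 : |(4:ℤ)| ≤ 4 := by norm_num
    have b2 : |(2:ℤ)| ≤ 2 := by norm_num
    have bΔ := abs_sub_le' (abs_mul_le' (abs_mul_le' b4 hA) hC) (abs_mul_le' hB hB)
    rw [← sq B, ← hΔ] at bΔ
    have be := abs_sub_le' (abs_mul_le' b2 (abs_mul_le' hB hD)) (abs_mul_le' b4 (abs_mul_le' hA hE))
    rw [← he] at be
    have bg := abs_sub_le' (abs_mul_le' hD hD) (abs_mul_le' b4 (abs_mul_le' hA hG))
    rw [← hg] at bg
    have bM := abs_add_le' (abs_mul_le' be be) (abs_mul_le' b4 (abs_mul_le' bΔ bg))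
    rw [← hM] at bM
    have h5 : (243:ℤ) ≤ n^5 := by
      calc (243:ℤ) = 3^5 := by norm_num
        _ ≤ _ := by gcongr
    have h6 : (243:ℤ)*n^56 ≤ n^61 := by
      calc (243:ℤ)*n^56 ≤ n^5*n^56 := by gcongr
        _ = _ := by ring
    have h7 : (0:ℤ) ≤ (n:ℤ)^56 := by positivity
    have : (N:ℤ) ≤ n^61 := by
      refine (le_abs_self _).trans (bM.trans ?_)
      ring_nf at h6 h7 ⊢
      linarith
    exact_mod_cast this
  have h1 := solcount hN0 hpos (S.image f) (by
    intro q hq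
    obtain ⟨r, hr, rfl⟩ := Finset.mem_image.1 hq
    exact hsol r hr)
  rw [Finset.card_image_of_injective _ hf] at h1
  have h2 := card_div_bound' hN0 hn hNle
  have hnpos : (0:ℝ) < n := by positivity
  calc (S.card:ℝ) ≤ 20*(N.divisors.card:ℝ)^2 := by exact_mod_cast h1
    _ ≤ 20*((n:ℝ)^((2*(61:ℕ)+32)/Real.log (Real.log n)))^2 := by gcongr
    _ = _ := by
      rw [← Real.rpow_natCast, ← Real.rpow_mul hnpos.le]
      congr 2
      push_cast
      ring

lemma plane_count {n : ℕ} (hn : 3 ≤ n) {x0 y0 a b c d : ℝ} (hδ : a*d-b*c ≠ 0)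
    (S : Finset (ℤ × ℤ)) (hgrid : ∀ q ∈ S, (1 ≤ q.1 ∧ q.1 ≤ n) ∧ (1 ≤ q.2 ∧ q.2 ≤ n))
    (hS : ∀ q ∈ S, ∃ u v : ℝ, u^2+v^2=1 ∧ (q.1:ℝ) = x0+a*u+b*v ∧ (q.2:ℝ) = y0+c*u+d*v) :
    (S.card : ℝ) ≤ 20 * (n:ℝ)^((308:ℝ)/Real.log (Real.log n)) := by
  by_cases hc : S.card < 5
  · have h1 : (1:ℝ) ≤ (n:ℝ)^((308:ℝ)/Real.log (Real.log n)) := by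
      apply Real.one_le_rpow
      · exact_mod_cast (by omega : 1 ≤ n)
      · have := (loglog_pos hn).2
        positivity
    have h2 : (S.card:ℝ) ≤ 5 := by exact_mod_cast hc.le
    linarith
  push Not at hc
  let P : Fin 5 → ℤ × ℤ := fun i => (S.equivFin.symm (Fin.castLE hc i) : ℤ × ℤ)
  have hPS : ∀ i, P i ∈ S := fun i => (S.equivFin.symm (Fin.castLE hc i)).2
  have hPinj : Function.Injective P := by
    intro i j h
    exact Fin.castLE_injective hc (S.equivFin.symm.injective (Subtype.ext h))
  choose u v huv hx hy using fun i => hS (P i) (hPS i)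
  obtain ⟨A, B, C, D, E, G, hA, hB, hC, hD, hE, hG, hpos, hF⟩ :=
    conic_exists hn hδ (fun i => (P i).1) (fun i => (P i).2) (fun i => (hgrid _ (hPS i)).1)
      (fun i => (hgrid _ (hPS i)).2) u v huv hx hy (by
        intro i j hij h
        apply hij
        apply hPinj
        rw [Prod.mk.injEq] at h
        ext
        · have : ((P i).1:ℝ) = (P j).1 := by rw [hx, hx, h.1, h.2]
          exact_mod_cast this
        · have : ((P i).2:ℝ) = (P j).2 := by rw [hy, hy, h.1, h.2]
          exact_mod_cast this)
  refine quad_count hn hA hB hC hD hE hG hpos S (by omega) ?_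
  intro q hq
  obtain ⟨U, V, h1, h2, h3⟩ := hS q hq
  have := hF U V h1
  rw [← h2, ← h3] at this
  exact_mod_cast this

lemma affine_coord {m : ℕ} (φ : EuclideanSpace ℝ (Fin 2) →ᵃ[ℝ] EuclideanSpace ℝ (Fin m)) :
    ∃ o a b : Fin m → ℝ, ∀ (w : EuclideanSpace ℝ (Fin 2)) i, φ w i = o i + a i * w 0 + b i * w 1 := by
  refine ⟨fun i => φ 0 i, fun i => φ.linear (EuclideanSpace.single 0 1) i,
    fun i => φ.linear (EuclideanSpace.single 1 1) i, ?_⟩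
  intro w i
  have hw : w = w 0 • EuclideanSpace.single (0:Fin 2) (1:ℝ) + w 1 • EuclideanSpace.single (1:Fin 2) (1:ℝ) := by
    ext k; fin_cases k <;> simp
  have h1 : φ w = φ.linear w + φ 0 := by
    have := φ.map_vadd 0 w
    simpa using this
  rw [h1]
  conv_lhs => rw [hw]
  rw [map_add, map_smul, map_smul]
  simp
  ring

theorem lattice_points_on_ellipse :
    ∃ c : ℝ, 0 < c ∧ ∀ d : ℕ, 2 ≤ d → ∃ C : ℝ, 0 < C ∧ ∀ n : ℕ, 3 ≤ n →
      ∀ E : Set (EuclideanSpace ℝ (Fin d)), IsEllipse d E →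
        ((E ∩ grid d n).ncard : ℝ) ≤ C * (n : ℝ) ^ (c / Real.log (Real.log n)) := by
  refine ⟨308, by norm_num, fun d _ => ⟨20, by norm_num, ?_⟩⟩
  rintro n hn E ⟨φ, hφ, rfl⟩
  obtain ⟨o, a, b, hab⟩ := affine_coord φ
  obtain ⟨i, j, hδ⟩ : ∃ i j, a i * b j - b i * a j ≠ 0 := by
    by_contra hcon
    push Not at hcon
    by_cases hz : ∀ k, a k = 0 ∧ b k = 0
    · have : φ !₂[1, 0] = φ !₂[0, 0] := by
        ext k; rw [hab, hab, (hz k).1, (hz k).2]; ring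
      have := congrArg (fun w : EuclideanSpace ℝ (Fin 2) => w 0) (hφ this)
      simp at this
    · push Not at hz
      obtain ⟨k, hk⟩ := hz
      have : φ !₂[b k, -a k] = φ !₂[0, 0] := by
        ext l; rw [hab, hab]; simp; linarith [hcon l k]
      have h := hφ this
      have h0 := congrArg (fun w : EuclideanSpace ℝ (Fin 2) => w 0) h
      have h1 := congrArg (fun w : EuclideanSpace ℝ (Fin 2) => w 1) h
      simp at h0 h1
      exact hk h1 h0
  let π : EuclideanSpace ℝ (Fin d) → ℤ × ℤ := fun z => (⌊z i⌋, ⌊z j⌋)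
  set W := (φ '' Metric.sphere (0 : EuclideanSpace ℝ (Fin 2)) 1) ∩ grid d n with hW
  have hfl : ∀ z ∈ W, ∀ k, ((⌊z k⌋:ℤ):ℝ) = z k ∧ 1 ≤ ⌊z k⌋ ∧ ⌊z k⌋ ≤ n := by
    intro z hz k
    obtain ⟨m, h1, h2, h3⟩ := hz.2 k
    rw [h3, Int.floor_natCast]
    refine ⟨by simp, by exact_mod_cast h1, by exact_mod_cast h2⟩
  have hinj : Set.InjOn π W := by
    intro z hz z' hz' h
    simp only [π, Prod.mk.injEq] at h
    have e1 : z i = z' i := by rw [← (hfl z hz i).1, ← (hfl z' hz' i).1, h.1]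
    have e2 : z j = z' j := by rw [← (hfl z hz j).1, ← (hfl z' hz' j).1, h.2]
    obtain ⟨⟨w, _, rfl⟩, _⟩ := hz
    obtain ⟨⟨w', _, rfl⟩, _⟩ := hz'
    rw [hab, hab] at e1 e2
    congr 1
    ext k
    fin_cases k
    · apply mul_left_cancel₀ hδ
      simp only [Fin.zero_eta]
      linear_combination b j * e1 - b i * e2
    · apply mul_left_cancel₀ hδ
      simp only [Fin.mk_one]
      linear_combination a i * e2 - a j * e1
  have hfin : (π '' W).Finite := by
    apply ((Set.finite_Icc (1:ℤ) n).prod (Set.finite_Icc (1:ℤ) n)).subset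
    rintro _ ⟨z, hz, rfl⟩
    exact ⟨(hfl z hz i).2, (hfl z hz j).2⟩
  rw [← Set.ncard_image_of_injOn hinj, Set.ncard_eq_toFinset_card _ hfin]
  refine plane_count hn (x0 := o i) (y0 := o j) (a := a i) (b := b i) (c := a j) (d := b j) hδ _ ?_ ?_
  · intro q hq
    rw [Set.Finite.mem_toFinset] at hq
    obtain ⟨z, hz, rfl⟩ := hq
    exact ⟨(hfl z hz i).2, (hfl z hz j).2⟩
  · intro q hq
    rw [Set.Finite.mem_toFinset] at hq
    obtain ⟨z, hz, rfl⟩ := hq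
    have f1 := (hfl z hz i).1
    have f2 := (hfl z hz j).1
    obtain ⟨⟨w, hw, rfl⟩, _⟩ := hz
    refine ⟨w 0, w 1, ?_, ?_, ?_⟩
    · rw [mem_sphere_zero_iff_norm, EuclideanSpace.norm_eq] at hw
      simp [Fin.sum_univ_two] at hw
      exact hw
    · simp only [π]; rw [f1, hab]
    · simp only [π]; rw [f2, hab]
end

section
/- There exists a constant c > 0 such that for all integers d ≥ 2 and 1 ≤ k ≤ d − 1 there exists a constant C > 0 with the following property: for every n ≥ 3 and every k-sphere S in ℝ^d, the number of points of [n]^d lying on S is at most C · n^{k − 1 + c/log log n}. -/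
/-- A `k`-sphere in `ℝ^d`: the intersection of an affine subspace `A` of dimension `k+1`
with a sphere centered at a point of `A` with positive radius. -/
def IsKSphere (d k : ℕ) (S : Set (EuclideanSpace ℝ (Fin d))) : Prop :=
  ∃ (A : AffineSubspace ℝ (EuclideanSpace ℝ (Fin d))) (c : EuclideanSpace ℝ (Fin d)) (ρ : ℝ),
    Module.finrank ℝ A.direction = k + 1 ∧ c ∈ A ∧ 0 < ρ ∧
    S = (A : Set (EuclideanSpace ℝ (Fin d))) ∩ Metric.sphere c ρ


lemma prim_fiber (D N : ℤ) (hD : 0 < D) (hN : 0 < N) (x2 y2 : ℤ)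
    (h2 : y2 ^ 2 + D * x2 ^ 2 = N)
    (S : Finset (ℤ × ℤ)) (hS : ∀ p ∈ S, p.1 ^ 2 + D * p.2 ^ 2 = N)
    (hB : ∀ p ∈ S, N ∣ 2 * (p.2 * y2 - x2 * p.1)) : S.card ≤ 10 := by
  classical
  have key : ∀ p ∈ S, (p.1 * y2 + D * (p.2 * x2)) ^ 2 + D * (p.2 * y2 - x2 * p.1) ^ 2 = N ^ 2 := by
    intro p hp
    have := hS p hp
    calc _ = (p.1 ^ 2 + D * p.2 ^ 2) * (y2 ^ 2 + D * x2 ^ 2) := by ring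
      _ = N ^ 2 := by rw [this, h2]; ring
  have hcard : (Finset.Icc (-2 : ℤ) 2 ×ˢ (Finset.univ : Finset Bool)).card = 10 := by decide
  rw [← hcard]
  apply Finset.card_le_card_of_injOn
    (fun p => (2 * (p.2 * y2 - x2 * p.1) / N, decide (0 ≤ p.1 * y2 + D * (p.2 * x2))))
  · intro p hp
    have hp : p ∈ S := hp
    obtain ⟨j, hj⟩ := hB p hp
    have hk := key p hp
    simp only [Finset.coe_product, Set.mem_prod, Finset.coe_Icc, Set.mem_Icc, Finset.coe_univ,
      Set.mem_univ, and_true]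
    rw [hj, Int.mul_ediv_cancel_left _ hN.ne']
    have h4 : D * (N * j) ^ 2 ≤ 4 * N ^ 2 := by
      rw [← hj]; nlinarith [sq_nonneg (p.1 * y2 + D * (p.2 * x2))]
    have h5 : j ^ 2 ≤ 4 := by
      have : N ^ 2 * (D * j ^ 2) ≤ N ^ 2 * 4 := by nlinarith
      have := le_of_mul_le_mul_left this (by positivity)
      nlinarith [sq_nonneg j]
    constructor <;> nlinarith
  · intro p hp q hq hpq
    have hp : p ∈ S := hp
    have hq : q ∈ S := hq
    obtain ⟨j, hj⟩ := hB p hp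
    obtain ⟨j', hj'⟩ := hB q hq
    simp only [Prod.mk.injEq, decide_eq_decide] at hpq
    obtain ⟨e1, e2⟩ := hpq
    rw [hj, hj', Int.mul_ediv_cancel_left _ hN.ne', Int.mul_ediv_cancel_left _ hN.ne'] at e1
    subst e1
    have eB : p.2 * y2 - x2 * p.1 = q.2 * y2 - x2 * q.1 := by linarith
    have k1 := key p hp
    have k2 := key q hq
    rw [eB] at k1
    have eA : p.1 * y2 + D * (p.2 * x2) = q.1 * y2 + D * (q.2 * x2) := by
      have : (p.1 * y2 + D * (p.2 * x2)) ^ 2 = (q.1 * y2 + D * (q.2 * x2)) ^ 2 := by linarith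
      rcases sq_eq_sq_iff_eq_or_eq_neg.mp this with h | h
      · exact h
      · by_cases h0 : 0 ≤ p.1 * y2 + D * (p.2 * x2)
        · have := e2.mp h0; linarith
        · have : ¬ 0 ≤ q.1 * y2 + D * (q.2 * x2) := fun h => h0 (e2.mpr h)
          push Not at this h0; linarith
    have f1 : N * p.1 = N * q.1 := by
      rw [← h2]; linear_combination y2 * eA - D * x2 * eB
    have f2 : N * p.2 = N * q.2 := by
      rw [← h2]; linear_combination x2 * eA + y2 * eB
    exact Prod.ext (mul_left_cancel₀ hN.ne' f1) (mul_left_cancel₀ hN.ne' f2)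

lemma dvd_two_of_sq_dvd (D e : ℕ) (hD : Squarefree D) (h : e ^ 2 ∣ 4 * D) : e ∣ 2 := by
  rcases Nat.even_or_odd e with ⟨f, hf⟩ | ho
  · have : f ^ 2 ∣ D := by
      have h' : 4 * f ^ 2 ∣ 4 * D := by
        convert h using 1; rw [hf]; ring
      exact Nat.dvd_of_mul_dvd_mul_left (by norm_num) h'
    have hf1 : f = 1 := by
      have := hD f (by rwa [← sq])
      exact Nat.isUnit_iff.mp this
    subst hf1; simp [hf]
  · have hc : Nat.Coprime (e ^ 2) 4 := by
      have : Nat.Coprime e 2 := Nat.coprime_two_right.mpr ho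
      have := Nat.Coprime.pow 2 2 this
      simpa using this
    have h1 : e ^ 2 ∣ D := hc.dvd_of_dvd_mul_left h
    have := Nat.isUnit_iff.mp (hD e (by rwa [← sq]))
    simp [this]

lemma prim_count (D N : ℕ) (hD : Squarefree D) (hN : 0 < N)
    (S : Finset (ℤ × ℤ)) (hS : ∀ p ∈ S, p.1 ^ 2 + (D : ℤ) * p.2 ^ 2 = N)
    (hc : ∀ p ∈ S, IsCoprime p.1 p.2) : S.card ≤ 10 * N.divisors.card := by
  classical
  rcases S.eq_empty_or_nonempty with rfl | ⟨q, hq⟩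
  · simp
  have hDpos : 0 < D := Nat.pos_of_ne_zero hD.ne_zero
  have hXN : ∀ p ∈ S, IsCoprime p.2 (N : ℤ) := by
    intro p hp
    rw [← hS p hp]
    have h1 : IsCoprime p.2 (p.1 ^ 2) := (hc p hp).symm.pow_right
    have h2 := h1.add_mul_right_right (D * p.2)
    have h3 : p.1 ^ 2 + (D : ℤ) * p.2 ^ 2 = p.1 ^ 2 + (D * p.2) * p.2 := by ring
    rw [h3]; exact h2
  set g : ℤ × ℤ → ℕ := fun p => Int.gcd (q.2 * p.1 - p.2 * q.1) N with hg
  refine Finset.card_le_mul_card_image_of_maps_to (f := g) ?_ 10 ?_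
  · intro p hp
    rw [Nat.mem_divisors]
    refine ⟨?_, hN.ne'⟩
    have := Int.gcd_dvd_right (q.2 * p.1 - p.2 * q.1) N
    exact_mod_cast this
  intro b hb
  rcases (S.filter (fun p => g p = b)).eq_empty_or_nonempty with h0 | ⟨r, hr⟩
  · simp [h0]
  have hrS : r ∈ S := (Finset.mem_filter.mp hr).1
  -- basic divisibility facts
  obtain ⟨m, hm⟩ := (Nat.mem_divisors.mp hb).1
  have hbpos : 0 < b := Nat.pos_of_mem_divisors hb
  have hmN : (N : ℤ) = b * m := by exact_mod_cast hm
  have base : ∀ p ∈ S, g p = b → (b : ℤ) ∣ q.2 * p.1 - p.2 * q.1 ∧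
      (m : ℤ) ∣ q.2 * p.1 + p.2 * q.1 := by
    intro p hp hpb
    have h1 : (b : ℤ) ∣ q.2 * p.1 - p.2 * q.1 := by
      rw [← hpb]; exact Int.gcd_dvd_left _ _
    refine ⟨h1, ?_⟩
    have hprod : (q.2 * p.1 - p.2 * q.1) * (q.2 * p.1 + p.2 * q.1)
        = N * (q.2 ^ 2 - p.2 ^ 2) := by
      linear_combination q.2 ^ 2 * hS p hp - p.2 ^ 2 * hS q hq
    obtain ⟨u, hu⟩ := h1
    have hcop : IsCoprime (m : ℤ) u := by
      have hgp : Int.gcd (q.2 * p.1 - p.2 * q.1) N = b := hpb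
      rw [hu, hmN, Int.gcd_mul_left] at hgp
      have : Int.gcd u m = 1 := by
        simp only [Int.natAbs_natCast] at hgp
        exact Nat.eq_of_mul_eq_mul_left hbpos (by simpa using hgp)
      exact (Int.isCoprime_iff_gcd_eq_one.mpr this).symm
    apply hcop.dvd_of_dvd_mul_left
    refine ⟨q.2 ^ 2 - p.2 ^ 2, ?_⟩
    have hb0 : (b : ℤ) ≠ 0 := by exact_mod_cast hbpos.ne'
    apply mul_left_cancel₀ hb0
    rw [hu, hmN] at hprod
    linear_combination hprod
  -- e = gcd b m divides 2
  have he : Nat.gcd b m ∣ 2 := by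
    apply dvd_two_of_sq_dvd D _ hD
    obtain ⟨h1, h2⟩ := base r hrS (Finset.mem_filter.mp hr).2
    set e := Nat.gcd b m
    have heb : (e : ℤ) ∣ b := by exact_mod_cast Nat.gcd_dvd_left b m
    have hem : (e : ℤ) ∣ m := by exact_mod_cast Nat.gcd_dvd_right b m
    have heN : (e : ℤ) ^ 2 ∣ N := by rw [hmN, sq]; exact mul_dvd_mul heb hem
    have heN1 : (e : ℤ) ∣ N := (dvd_pow_self _ two_ne_zero).trans heN
    have h3 : (e : ℤ) ∣ q.2 * (2 * r.1) := by
      have := dvd_add (heb.trans h1) (hem.trans h2)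
      have e1 : q.2 * (2 * r.1) = q.2 * r.1 - r.2 * q.1 + (q.2 * r.1 + r.2 * q.1) := by ring
      rw [e1]; exact this
    have h4 : (e : ℤ) ∣ 2 * r.1 :=
      ((hXN q hq).symm.of_isCoprime_of_dvd_left heN1).dvd_of_dvd_mul_left h3
    have h5 : (e : ℤ) ^ 2 ∣ r.2 ^ 2 * (4 * D) := by
      have : r.2 ^ 2 * (4 * (D:ℤ)) = 4 * N - (2 * r.1) ^ 2 := by
        linear_combination 4 * hS r hrS
      rw [this]
      exact dvd_sub (heN.mul_left 4) (pow_dvd_pow_of_dvd h4 2)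
    have h6 : IsCoprime ((e : ℤ) ^ 2) (r.2 ^ 2) :=
      ((hXN r hrS).symm.of_isCoprime_of_dvd_left heN1).pow
    have := h6.dvd_of_dvd_mul_left h5
    exact_mod_cast this
  apply prim_fiber D N (by exact_mod_cast hDpos) (by exact_mod_cast hN) r.2 r.1 (hS r hrS)
  · intro p hp; exact hS p (Finset.mem_filter.mp hp).1
  · intro p hp
    obtain ⟨hpS, hpb⟩ := Finset.mem_filter.mp hp
    obtain ⟨a1, a2⟩ := base p hpS hpb
    obtain ⟨c1, c2⟩ := base r hrS (Finset.mem_filter.mp hr).2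
    have hbN : (b : ℤ) ∣ N := ⟨m, hmN⟩
    have hmN' : (m : ℤ) ∣ N := ⟨b, by rw [hmN]; ring⟩
    have k1 : (b : ℤ) ∣ p.2 * r.1 - r.2 * p.1 := by
      apply ((hXN q hq).symm.of_isCoprime_of_dvd_left hbN).dvd_of_dvd_mul_left
      have := dvd_sub (c1.mul_left p.2) (a1.mul_left r.2)
      convert this using 1; ring
    have k2 : (m : ℤ) ∣ p.2 * r.1 - r.2 * p.1 := by
      apply ((hXN q hq).symm.of_isCoprime_of_dvd_left hmN').dvd_of_dvd_mul_left
      have := dvd_sub (c2.mul_left p.2) (a2.mul_left r.2)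
      convert this using 1; ring
    have k3 : ((Nat.lcm b m : ℕ) : ℤ) ∣ p.2 * r.1 - r.2 * p.1 := by
      rw [Int.natCast_dvd] at k1 k2 ⊢
      exact Nat.lcm_dvd k1 k2
    have k4 : (N : ℤ) = (Nat.gcd b m : ℕ) * (Nat.lcm b m : ℕ) := by
      rw [hm]; exact_mod_cast (Nat.gcd_mul_lcm b m).symm
    rw [k4]
    exact mul_dvd_mul (by exact_mod_cast he) k3

lemma nonprim_count (D N : ℕ) (hD : Squarefree D) (hN : 0 < N)
    (S : Finset (ℤ × ℤ)) (hS : ∀ p ∈ S, p.1 ^ 2 + (D : ℤ) * p.2 ^ 2 = N) :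
    S.card ≤ 10 * N.divisors.card ^ 2 := by
  classical
  have hsq : ∀ p ∈ S, (Int.gcd p.1 p.2) ^ 2 ∣ N := by
    intro p hp
    have h1 : ((Int.gcd p.1 p.2 : ℕ) : ℤ) ^ 2 ∣ (N : ℤ) := by
      rw [← hS p hp]
      exact dvd_add (pow_dvd_pow_of_dvd (Int.gcd_dvd_left _ _) 2)
        ((pow_dvd_pow_of_dvd (Int.gcd_dvd_right _ _) 2).mul_left _)
    exact_mod_cast h1
  rw [sq, ← mul_assoc]
  refine Finset.card_le_mul_card_image_of_maps_to (f := fun p : ℤ × ℤ => Int.gcd p.1 p.2) ?_ _ ?_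
  · intro p hp
    exact Nat.mem_divisors.mpr ⟨(dvd_pow_self _ two_ne_zero).trans (hsq p hp), hN.ne'⟩
  intro b hb
  rcases (S.filter (fun p => Int.gcd p.1 p.2 = b)).eq_empty_or_nonempty with h0 | ⟨r, hr⟩
  · simp [h0]
  have hbpos : 0 < b := Nat.pos_of_mem_divisors hb
  have hb0 : (b : ℤ) ≠ 0 := by exact_mod_cast hbpos.ne'
  obtain ⟨M, hM⟩ : b ^ 2 ∣ N := by
    rw [← (Finset.mem_filter.mp hr).2]; exact hsq r (Finset.mem_filter.mp hr).1
  have hMpos : 0 < M := Nat.pos_of_ne_zero (by rintro rfl; simp at hM; omega)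
  have hex : ∀ p ∈ S.filter (fun p => Int.gcd p.1 p.2 = b),
      p.1 = b * (p.1 / b) ∧ p.2 = b * (p.2 / b) := by
    intro p hp
    have := (Finset.mem_filter.mp hp).2
    constructor
    · exact (Int.mul_ediv_cancel' (by rw [← this]; exact Int.gcd_dvd_left _ _)).symm
    · exact (Int.mul_ediv_cancel' (by rw [← this]; exact Int.gcd_dvd_right _ _)).symm
  have hcard : (S.filter (fun p => Int.gcd p.1 p.2 = b)).card =
      ((S.filter (fun p => Int.gcd p.1 p.2 = b)).image
        (fun p : ℤ × ℤ => (p.1 / (b:ℤ), p.2 / (b:ℤ)))).card := by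
    symm
    apply Finset.card_image_of_injOn
    intro p hp q hq h
    simp only [Prod.mk.injEq] at h
    have h1 := hex p hp
    have h2 := hex q hq
    exact Prod.ext (by rw [h1.1, h2.1, h.1]) (by rw [h1.2, h2.2, h.2])
  change (S.filter (fun p => Int.gcd p.1 p.2 = b)).card ≤ _
  rw [hcard]
  refine (prim_count D M hD hMpos _ ?_ ?_).trans ?_
  · intro p' hp'
    obtain ⟨p, hp, rfl⟩ := Finset.mem_image.mp hp'
    have h1 := hex p hp
    have h2 := hS p (Finset.mem_filter.mp hp).1
    rw [h1.1, h1.2, hM] at h2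
    push_cast at h2
    have hb2 : (b : ℤ) ^ 2 ≠ 0 := pow_ne_zero _ hb0
    apply mul_left_cancel₀ hb2
    linear_combination h2
  · intro p' hp'
    obtain ⟨p, hp, rfl⟩ := Finset.mem_image.mp hp'
    have h1 := (Finset.mem_filter.mp hp).2
    have := Int.gcd_div_gcd_div_gcd (i := p.1) (j := p.2) (by rw [h1]; exact hbpos)
    rw [h1] at this
    exact Int.isCoprime_iff_gcd_eq_one.mpr this
  · gcongr
    exact ⟨b ^ 2, by rw [hM]; ring⟩

lemma quad_count_s10 (Δ N : ℕ) (hΔ : 0 < Δ) (hN : 0 < N)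
    (S : Finset (ℤ × ℤ)) (hS : ∀ p ∈ S, p.1 ^ 2 + (Δ : ℤ) * p.2 ^ 2 = N) :
    S.card ≤ 10 * N.divisors.card ^ 2 := by
  classical
  obtain ⟨a, b, hab, ha⟩ := Nat.sq_mul_squarefree Δ
  have hb0 : (b : ℤ) ≠ 0 := by
    intro h
    have : b = 0 := by exact_mod_cast h
    subst this; simp at hab; omega
  have hcard : S.card = (S.image (fun p : ℤ × ℤ => (p.1, (b:ℤ) * p.2))).card := by
    symm
    apply Finset.card_image_of_injOn
    intro p hp q hq h
    simp only [Prod.mk.injEq] at h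
    exact Prod.ext h.1 (mul_left_cancel₀ hb0 h.2)
  rw [hcard]
  apply nonprim_count a N ha hN
  intro p' hp'
  obtain ⟨p, hp, rfl⟩ := Finset.mem_image.mp hp'
  have := hS p hp
  rw [← hab] at this
  push_cast at this
  linear_combination this

lemma divisor_bound (N : ℕ) (hN : 0 < N) (l : ℝ) (hl : 0 < l) :
    (N.divisors.card : ℝ) ≤ Real.exp ((2 * Real.log N + 16 * Real.exp l) / l) := by
  classical
  have hlog2 : (1/2 : ℝ) < Real.log 2 := by have := Real.log_two_gt_d9; linarith
  set Z := Real.exp (l / 2) with hZ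
  have hfac : ∀ p ∈ N.primeFactors, ((N.factorization p + 1 : ℕ) : ℝ) ≤
      Real.exp (2 / l * (N.factorization p * Real.log p)) *
        (if (p : ℝ) < Z then Real.exp l else 1) := by
    intro p hp
    have hpp := Nat.prime_of_mem_primeFactors hp
    have hp2 : (2 : ℝ) ≤ p := by exact_mod_cast hpp.two_le
    set a := N.factorization p
    have ha0 : (0 : ℝ) ≤ a := Nat.cast_nonneg _
    push_cast
    split_ifs with h
    · have h1 : (1 : ℝ) + a / l ≤ Real.exp (2 / l * (a * Real.log p)) := by
        have hlp : (1/2 : ℝ) ≤ Real.log p :=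
          hlog2.le.trans (Real.log_le_log (by norm_num) hp2)
        calc (1 : ℝ) + a / l = 2 / l * (a * (1/2)) + 1 := by ring
          _ ≤ 2 / l * (a * Real.log p) + 1 := by gcongr
          _ ≤ _ := Real.add_one_le_exp _
      have h2 : 1 + l ≤ Real.exp l := by linarith [Real.add_one_le_exp l]
      calc (a : ℝ) + 1 ≤ (1 + a / l) * (1 + l) := by
            have : (1 + a / l) * (1 + l) = 1 + a + l + a / l := by field_simp; ring
            rw [this]; have : 0 ≤ a / l := by positivity
            linarith
        _ ≤ _ := by gcongr
    · rw [mul_one]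
      push Not at h
      have hlp : l / 2 ≤ Real.log p := by
        rw [Real.le_log_iff_exp_le (by linarith)]; exact h
      calc (a : ℝ) + 1 ≤ Real.exp a := Real.add_one_le_exp _
        _ = Real.exp (2 / l * (a * (l / 2))) := by congr 1; field_simp
        _ ≤ _ := by gcongr
  have hlogN : ∑ p ∈ N.primeFactors, (N.factorization p * Real.log p) = Real.log N := by
    conv_rhs => rw [← Nat.prod_factorization_pow_eq_self hN.ne']
    rw [Finsupp.prod, Nat.cast_prod, Real.log_prod]
    · simp
    · intro p hp
      have := Nat.prime_of_mem_primeFactors (by simpa using hp : p ∈ N.primeFactors)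
      have := this.pos
      positivity
  have hprod : (∏ p ∈ N.primeFactors, (if (p : ℝ) < Z then Real.exp l else 1)) ≤
      Real.exp (l * Z) := by
    rw [Finset.prod_ite, Finset.prod_const, Finset.prod_const_one, mul_one, ← Real.exp_nat_mul]
    apply Real.exp_le_exp.mpr
    rw [mul_comm]
    apply mul_le_mul_of_nonneg_left _ hl.le
    have hsub : N.primeFactors.filter (fun p : ℕ => (p : ℝ) < Z) ⊆ Finset.Icc 1 ⌊Z⌋₊ := by
      intro p hp
      obtain ⟨h1, h2⟩ := Finset.mem_filter.mp hp
      exact Finset.mem_Icc.mpr ⟨(Nat.prime_of_mem_primeFactors h1).pos, Nat.le_floor h2.le⟩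
    have := Finset.card_le_card hsub
    simp only [Nat.card_Icc, Nat.add_sub_cancel] at this
    calc _ ≤ ((⌊Z⌋₊ : ℕ) : ℝ) := by exact_mod_cast this
      _ ≤ Z := Nat.floor_le (Real.exp_pos _).le
  rw [Nat.card_divisors hN.ne', Nat.cast_prod]
  calc _ ≤ ∏ p ∈ N.primeFactors, (Real.exp (2 / l * (N.factorization p * Real.log p)) *
        (if (p : ℝ) < Z then Real.exp l else 1)) :=
        Finset.prod_le_prod (fun _ _ => Nat.cast_nonneg _) hfac
    _ = Real.exp (2 / l * Real.log N) *
        ∏ p ∈ N.primeFactors, (if (p : ℝ) < Z then Real.exp l else 1) := by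
        rw [Finset.prod_mul_distrib, ← Real.exp_sum, ← Finset.mul_sum, hlogN]
    _ ≤ Real.exp (2 / l * Real.log N) * Real.exp (l * Z) := by gcongr
    _ ≤ _ := by
        rw [← Real.exp_add]
        apply Real.exp_le_exp.mpr
        rw [add_div, mul_comm_div, mul_div_assoc', mul_div_assoc]
        have : l * Z ≤ 16 * Real.exp l / l := by
          rw [le_div_iff₀ hl]
          have h1 : l / 4 ≤ Real.exp (l / 4) := by linarith [Real.add_one_le_exp (l / 4)]
          have h2 : Z = Real.exp (l / 4) ^ 2 := by
            rw [hZ, ← Real.exp_nat_mul]; congr 1; push_cast; ring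
          have h3 : Real.exp l = Z * Z := by
            rw [hZ, ← Real.exp_add]; congr 1; ring
          have h4 : (l / 4) ^ 2 ≤ Z := by rw [h2]; gcongr
          have hZ0 : 0 < Z := Real.exp_pos _
          rw [h3]; nlinarith
        have e : 2 / l * Real.log N = 2 * (Real.log N / l) := by ring
        linarith [this, e]

lemma int_inner (d n : ℕ) (x y p q : EuclideanSpace ℝ (Fin d))
    (hx : x ∈ grid d n) (hy : y ∈ grid d n) (hp : p ∈ grid d n) (hq : q ∈ grid d n) :
    ∃ z : ℤ, (z : ℝ) = inner ℝ (x - p) (y - q) ∧ |z| ≤ (d : ℤ) * n ^ 2 := by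
  choose a ha1 ha2 ha using hx
  choose b hb1 hb2 hb using hy
  choose r hr1 hr2 hr using hp
  choose s hs1 hs2 hs using hq
  refine ⟨∑ i, ((a i : ℤ) - r i) * ((b i : ℤ) - s i), ?_, ?_⟩
  · rw [PiLp.inner_apply]
    push_cast
    apply Finset.sum_congr rfl
    intro i _
    simp [ha, hb, hr, hs]
    ring
  · refine (Finset.abs_sum_le_sum_abs _ _).trans ?_
    have : ∀ i ∈ (Finset.univ : Finset (Fin d)),
        |((a i : ℤ) - r i) * ((b i : ℤ) - s i)| ≤ (n : ℤ) ^ 2 := by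
      intro i _
      rw [abs_mul, sq]
      have h1 := ha1 i
      have h2 := ha2 i
      have h3 := hb1 i
      have h4 := hb2 i
      have h5 := hr1 i
      have h6 := hr2 i
      have h7 := hs1 i
      have h8 := hs2 i
      apply mul_le_mul _ _ (abs_nonneg _) (by positivity)
      · rw [abs_le]; constructor <;> omega
      · rw [abs_le]; constructor <;> omega
    have := Finset.sum_le_card_nsmul _ _ _ this
    simpa using this

lemma circle_count (d n : ℕ) (V : Submodule ℝ (EuclideanSpace ℝ (Fin d)))
    (hV : Module.finrank ℝ V ≤ 2) (c : EuclideanSpace ℝ (Fin d)) (ρ : ℝ)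
    (T : Finset (EuclideanSpace ℝ (Fin d))) (hT : ∀ x ∈ T, x ∈ grid d n)
    (hTV : ∀ x ∈ T, ∀ y ∈ T, x - y ∈ V) (hTs : ∀ x ∈ T, ‖x - c‖ = ρ) :
    T.card ≤ 2 ∨ ∃ N : ℕ, 0 < N ∧ N ≤ 5 * d ^ 4 * n ^ 8 ∧ T.card ≤ 10 * N.divisors.card ^ 2 := by
  classical
  rcases Nat.lt_or_ge 2 T.card with h3 | h3
  swap
  · left; exact h3
  right
  obtain ⟨p0, p1, p2, hp0, hp1, hp2, h01, h02, h12⟩ := Finset.two_lt_card_iff.mp h3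
  set u := p1 - p0 with hu
  set v := p2 - p0 with hv
  have hu0 : u ≠ 0 := sub_ne_zero.mpr h01.symm
  have hv0 : v ≠ 0 := sub_ne_zero.mpr h02.symm
  have huv : u ≠ v := fun h => h12 (sub_left_injective h)
  have huV : u ∈ V := hTV _ hp1 _ hp0
  have hvV : v ∈ V := hTV _ hp2 _ hp0
  -- the sphere equation
  have hsph : ∀ x ∈ T, inner ℝ (x - p0) (x - p0) = -2 * inner ℝ (x - p0) (p0 - c) := by
    intro x hx
    have h1 : ‖(x - p0) + (p0 - c)‖ = ‖p0 - c‖ := by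
      rw [sub_add_sub_cancel, hTs x hx, hTs p0 hp0]
    have h2 := norm_add_sq_real (x - p0) (p0 - c)
    rw [h1, ← real_inner_self_eq_norm_sq (x - p0)] at h2
    linarith
  obtain ⟨E, hE, hEb⟩ := int_inner d n p1 p1 p0 p0 (hT _ hp1) (hT _ hp1) (hT _ hp0) (hT _ hp0)
  obtain ⟨F, hF, hFb⟩ := int_inner d n p1 p2 p0 p0 (hT _ hp1) (hT _ hp2) (hT _ hp0) (hT _ hp0)
  obtain ⟨G, hG, hGb⟩ := int_inner d n p2 p2 p0 p0 (hT _ hp2) (hT _ hp2) (hT _ hp0) (hT _ hp0)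
  have hsu := hsph p1 hp1
  have hsv := hsph p2 hp2
  rw [← hu] at hE hF hsu
  rw [← hv] at hF hG hsv
  have hF' : (F : ℝ) = inner ℝ v u := by rw [hF, real_inner_comm]
  have hGpos : (0 : ℝ) < G := by rw [hG]; exact real_inner_self_pos.mpr hv0
  have hGpos' : 0 < G := by exact_mod_cast hGpos
  -- Gram determinant
  have hgram : inner ℝ ((G : ℝ) • u - (F : ℝ) • v) ((G : ℝ) • u - (F : ℝ) • v)
      = (G : ℝ) * (E * G - F ^ 2) := by
    simp only [inner_sub_left, inner_sub_right, real_inner_smul_left, real_inner_smul_right,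
      ← hE, ← hF, ← hG, ← hF']
    ring
  have hΔ : (0 : ℝ) < E * G - F ^ 2 := by
    by_contra hneg
    push Not at hneg
    have h0 : inner ℝ ((G : ℝ) • u - (F : ℝ) • v) ((G : ℝ) • u - (F : ℝ) • v) ≤ 0 := by
      rw [hgram]; exact mul_nonpos_of_nonneg_of_nonpos hGpos.le hneg
    have h1 : (G : ℝ) • u - (F : ℝ) • v = 0 := by
      by_contra h; exact absurd (real_inner_self_pos.mpr h) (not_lt.mpr h0)
    have h2 : u = ((F : ℝ) / G) • v := by
      rw [div_eq_inv_mul, mul_smul, ← sub_eq_zero.mp h1, smul_smul, inv_mul_cancel₀ hGpos.ne',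
        one_smul]
    set r := (F : ℝ) / G
    rw [h2, real_inner_smul_left, real_inner_smul_left, real_inner_smul_right, ← hG] at hsu
    rw [← hG] at hsv
    have h3 : r * (r - 1) * G = 0 := by linear_combination hsu - r * hsv
    have h4 : r * (r - 1) = 0 := (mul_eq_zero.mp h3).resolve_right hGpos.ne'
    rcases mul_eq_zero.mp h4 with h | h
    · exact hu0 (by rw [h2, h, zero_smul])
    · exact huv (by rw [h2, sub_eq_zero.mp h, one_smul])
  have hΔ' : 0 < E * G - F ^ 2 := by exact_mod_cast hΔ
  -- u, v span V
  have hspan : ∀ w ∈ V, ∃ α β : ℝ, α • u + β • v = w := by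
    have hli : LinearIndependent ℝ ![u, v] := by
      rw [LinearIndependent.pair_iff]
      intro s t hst
      have e1 : s * E + t * F = 0 := by
        have : inner ℝ (s • u + t • v) u = 0 := by rw [hst, inner_zero_left]
        rwa [inner_add_left, real_inner_smul_left, real_inner_smul_left, ← hE, ← hF'] at this
      have e2 : s * F + t * G = 0 := by
        have : inner ℝ (s • u + t • v) v = 0 := by rw [hst, inner_zero_left]
        rwa [inner_add_left, real_inner_smul_left, real_inner_smul_left, ← hF, ← hG] at this
      constructor
      · apply (mul_eq_zero.mp (_ : s * (E * G - F ^ 2) = 0)).resolve_right hΔ.ne'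
        linear_combination G * e1 - F * e2
      · apply (mul_eq_zero.mp (_ : t * (E * G - F ^ 2) = 0)).resolve_right hΔ.ne'
        linear_combination E * e2 - F * e1
    have hle : Submodule.span ℝ (Set.range ![u, v]) ≤ V := by
      rw [Submodule.span_le]
      rintro _ ⟨i, rfl⟩
      fin_cases i
      · exact huV
      · exact hvV
    have heq := Submodule.eq_of_le_of_finrank_le hle (by
      rw [finrank_span_eq_card hli]; simpa using hV)
    intro w hw
    rw [← heq] at hw
    have hr : Set.range ![u, v] = {u, v} := by simp [Set.pair_comm]
    rw [hr, Submodule.mem_span_pair] at hw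
    exact hw
  -- the integer data
  have hs : ∀ x ∈ T, ∃ z : ℤ, (z : ℝ) = inner ℝ (x - p0) u := fun x hx => by
    obtain ⟨z, hz, _⟩ := int_inner d n x p1 p0 p0 (hT _ hx) (hT _ hp1) (hT _ hp0) (hT _ hp0)
    exact ⟨z, hz⟩
  have ht : ∀ x ∈ T, ∃ z : ℤ, (z : ℝ) = inner ℝ (x - p0) v := fun x hx => by
    obtain ⟨z, hz, _⟩ := int_inner d n x p2 p0 p0 (hT _ hx) (hT _ hp2) (hT _ hp0) (hT _ hp0)
    exact ⟨z, hz⟩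
  choose! s hs using hs
  choose! t ht using ht
  set Δ : ℤ := E * G - F ^ 2 with hΔdef
  set N : ℤ := G ^ 2 * ((E - F) ^ 2 + Δ) with hNdef
  have hNpos : 0 < N := by positivity
  have hcard : T.card = (T.image (fun x =>
      (2 * (G * s x - F * t x) - G * (E - F), 2 * t x - G))).card := by
    symm
    apply Finset.card_image_of_injOn
    intro x hx y hy hxy
    have hx : x ∈ T := hx
    have hy : y ∈ T := hy
    simp only [Prod.mk.injEq] at hxy
    obtain ⟨e1, e2⟩ := hxy
    have et : t x = t y := by linarith
    have es : s x = s y := by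
      rw [et] at e1
      apply mul_left_cancel₀ hGpos'.ne'
      linarith
    have k1 : inner ℝ (x - y) u = 0 := by
      have : x - y = (x - p0) - (y - p0) := by abel
      rw [this, inner_sub_left, ← hs x hx, ← hs y hy, es, sub_self]
    have k2 : inner ℝ (x - y) v = 0 := by
      have : x - y = (x - p0) - (y - p0) := by abel
      rw [this, inner_sub_left, ← ht x hx, ← ht y hy, et, sub_self]
    obtain ⟨α, β, hαβ⟩ := hspan _ (hTV x hx y hy)
    have k3 : inner ℝ (x - y) (x - y) = 0 := by
      conv_lhs => rw [← hαβ, inner_add_right, real_inner_smul_right, real_inner_smul_right, hαβ]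
      rw [k1, k2]; simp
    exact sub_eq_zero.mp (inner_self_eq_zero.mp k3)
  refine ⟨N.toNat, by omega, ?_, ?_⟩
  · have hE0 : 0 ≤ E := by
      have : (0 : ℝ) ≤ E := by rw [hE]; exact real_inner_self_nonneg
      exact_mod_cast this
    rw [abs_le] at hEb hFb hGb
    set m : ℤ := (d : ℤ) * n ^ 2 with hm
    have : N ≤ 5 * (d : ℤ) ^ 4 * n ^ 8 := by
      have e : 5 * (d : ℤ) ^ 4 * n ^ 8 = m ^ 2 * ((2 * m) ^ 2 + m * m) := by rw [hm]; ring
      rw [e, hNdef]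
      have a1 : G ^ 2 ≤ m ^ 2 := by gcongr; exact hGb.2
      have a2 : (E - F) ^ 2 ≤ (2 * m) ^ 2 := by
        apply sq_le_sq'  <;> linarith
      have a3 : Δ ≤ m * m := by
        have : E * G ≤ m * m := mul_le_mul hEb.2 hGb.2 hGpos'.le (hE0.trans hEb.2)
        rw [hΔdef]; nlinarith [sq_nonneg F]
      gcongr
    have h2 : N ≤ ((5 * d ^ 4 * n ^ 8 : ℕ) : ℤ) := by push_cast; exact this
    omega
  · rw [hcard]
    apply quad_count_s10 Δ.toNat N.toNat (by omega) (by omega)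
    intro p hp
    obtain ⟨x, hx, rfl⟩ := Finset.mem_image.mp hp
    rw [Int.toNat_of_nonneg hΔ'.le, Int.toNat_of_nonneg hNpos.le]
    obtain ⟨α, β, hαβ⟩ := hspan _ (hTV x hx p0 hp0)
    have es : (s x : ℝ) = α * E + β * F := by
      rw [hs x hx, ← hαβ, inner_add_left, real_inner_smul_left, real_inner_smul_left, ← hE, ← hF']
    have et : (t x : ℝ) = α * F + β * G := by
      rw [ht x hx, ← hαβ, inner_add_left, real_inner_smul_left, real_inner_smul_left, ← hF, ← hG]
    have hq := hsph x hx
    rw [← hαβ] at hq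
    simp only [inner_add_left, inner_add_right, real_inner_smul_left, real_inner_smul_right,
      ← hE, ← hF, ← hG, ← hF'] at hq
    rw [← hE] at hsu
    rw [← hG] at hsv
    have hq2 : α ^ 2 * E + 2 * α * β * F + β ^ 2 * G = α * E + β * G := by
      linear_combination hq - α * hsu - β * hsv
    have : ((2 * (G * s x - F * t x) - G * (E - F) : ℤ) : ℝ) ^ 2
        + (Δ : ℝ) * ((2 * t x - G : ℤ) : ℝ) ^ 2 = (N : ℝ) := by
      rw [hNdef, hΔdef]
      push_cast
      rw [es, et]
      linear_combination 4 * (E * G - F ^ 2 : ℝ) * G * hq2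
    exact_mod_cast this

lemma slice_count (d n : ℕ) (hn : 1 ≤ n) (c : EuclideanSpace ℝ (Fin d)) (ρ : ℝ) (B : ℕ)
    (hB : ∀ (V : Submodule ℝ (EuclideanSpace ℝ (Fin d))), Module.finrank ℝ V ≤ 2 →
      ∀ T : Finset (EuclideanSpace ℝ (Fin d)), (∀ x ∈ T, x ∈ grid d n) →
      (∀ x ∈ T, ∀ y ∈ T, x - y ∈ V) → (∀ x ∈ T, ‖x - c‖ = ρ) → T.card ≤ B) (k : ℕ) :
    ∀ (V : Submodule ℝ (EuclideanSpace ℝ (Fin d))), Module.finrank ℝ V ≤ k + 2 →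
      ∀ T : Finset (EuclideanSpace ℝ (Fin d)), (∀ x ∈ T, x ∈ grid d n) →
      (∀ x ∈ T, ∀ y ∈ T, x - y ∈ V) → (∀ x ∈ T, ‖x - c‖ = ρ) → T.card ≤ B * n ^ k := by
  classical
  induction k with
  | zero => simpa using hB
  | succ k ih =>
    intro V hV T hT hTV hTs
    rcases Nat.lt_or_ge (k + 2) (Module.finrank ℝ V) with h | h
    swap
    · refine (ih V h T hT hTV hTs).trans ?_
      gcongr
      omega
    have hVb : V ≠ ⊥ := by
      rintro rfl
      simp at h
    obtain ⟨e, heV, he0⟩ := Submodule.exists_mem_ne_zero_of_ne_bot hVb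
    obtain ⟨i, hi⟩ : ∃ i, e i ≠ 0 := by
      by_contra hcon
      push Not at hcon
      exact he0 (by ext i; simpa using hcon i)
    set W := V ⊓ LinearMap.ker
      (EuclideanSpace.proj i : EuclideanSpace ℝ (Fin d) →L[ℝ] ℝ).toLinearMap
      with hW
    have hlt : W < V := by
      refine lt_of_le_of_ne inf_le_left ?_
      intro heq
      have : e ∈ W := by rw [heq]; exact heV
      have := (Submodule.mem_inf.mp this).2
      exact hi (by simpa using this)
    have hWr : Module.finrank ℝ W ≤ k + 2 := by
      have := Submodule.finrank_lt_finrank_of_lt hlt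
      omega
    have hcard : ((Finset.Icc 1 n).image (fun m : ℕ => (m : ℝ))).card ≤ n := by
      refine Finset.card_image_le.trans ?_
      simp
    have key : T.card ≤ (B * n ^ k) * ((Finset.Icc 1 n).image (fun m : ℕ => (m : ℝ))).card := by
      refine Finset.card_le_mul_card_image_of_maps_to (f := fun x => x i) ?_ _ ?_
      · intro x hx
        obtain ⟨m, h1, h2, h3⟩ := hT x hx i
        exact Finset.mem_image.mpr ⟨m, Finset.mem_Icc.mpr ⟨h1, h2⟩, h3.symm⟩
      · intro b _
        apply ih W hWr
        · intro x hx; exact hT x (Finset.mem_filter.mp hx).1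
        · intro x hx y hy
          obtain ⟨hx1, hx2⟩ := Finset.mem_filter.mp hx
          obtain ⟨hy1, hy2⟩ := Finset.mem_filter.mp hy
          refine Submodule.mem_inf.mpr ⟨hTV x hx1 y hy1, ?_⟩
          simp only [] at hx2 hy2
          simp [hx2, hy2]
        · intro x hx; exact hTs x (Finset.mem_filter.mp hx).1
    calc T.card ≤ _ := key
      _ ≤ B * n ^ k * n := by gcongr
      _ = _ := by ring

lemma grid_finite (d n : ℕ) : (grid d n).Finite := by
  have h : (Set.univ.pi (fun _ : Fin d => ((fun m : ℕ => (m : ℝ)) '' Set.Icc 1 n))).Finite :=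
    Set.Finite.pi' (fun _ => (Set.finite_Icc 1 n).image _) |>.subset (by
      intro x hx i; exact hx i (Set.mem_univ i))
  refine (h.preimage (f := fun x : EuclideanSpace ℝ (Fin d) => (x : Fin d → ℝ)) ?_).subset ?_
  · intro x _ y _ hxy
    ext i; exact congrFun hxy i
  · intro x hx i _
    obtain ⟨m, h1, h2, h3⟩ := hx i
    exact ⟨m, ⟨h1, h2⟩, h3.symm⟩

theorem lattice_points_on_kspheres :
    ∃ c : ℝ, 0 < c ∧ ∀ d k : ℕ, 2 ≤ d → 1 ≤ k → k ≤ d - 1 →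
      ∃ C : ℝ, 0 < C ∧ ∀ n : ℕ, 3 ≤ n →
        ∀ S : Set (EuclideanSpace ℝ (Fin d)), IsKSphere d k S →
          ((S ∩ grid d n).ncard : ℝ) ≤
            C * (n : ℝ) ^ ((k : ℝ) - 1 + c / Real.log (Real.log n)) := by
  classical
  refine ⟨64, by norm_num, ?_⟩
  intro d k hd hk hkd
  set l3 := Real.log (Real.log 3) with hl3
  have hlog3 : 1 < Real.log 3 := by
    rw [Real.lt_log_iff_exp_lt (by norm_num)]
    have := Real.exp_one_lt_d9; linarith
  have hl3pos : 0 < l3 := Real.log_pos hlog3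
  set K : ℝ := Real.log (5 * d ^ 4) with hK
  have hdR : (2 : ℝ) ≤ d := by exact_mod_cast hd
  have hK0 : 0 ≤ K := by
    apply Real.log_nonneg
    have : (1 : ℝ) ≤ (d : ℝ) ^ 4 := one_le_pow₀ (by linarith)
    linarith
  refine ⟨2 + 10 * Real.exp (4 * K / l3), by positivity, ?_⟩
  intro n hn S hS
  obtain ⟨A, c, ρ, hA, -, -, rfl⟩ := hS
  have hnR : (3 : ℝ) ≤ n := by exact_mod_cast hn
  have hn0 : (0 : ℝ) < n := by linarith
  set L := Real.log n with hL
  have hL1 : Real.log 3 ≤ L := Real.log_le_log (by norm_num) hnR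
  set l := Real.log L with hl
  have hll : l3 ≤ l := Real.log_le_log (by linarith) hL1
  have hlpos : 0 < l := hl3pos.trans_le hll
  have hLpos : 0 < L := by linarith
  have hexpl : Real.exp l = L := Real.exp_log hLpos
  set R : ℝ := (2 + 10 * Real.exp (4 * K / l3)) * (n : ℝ) ^ (64 / l) with hR
  have hR0 : 0 ≤ R := by positivity
  have hpow : (n : ℝ) ^ (64 / l) = Real.exp (64 * L / l) := by
    rw [Real.rpow_def_of_pos hn0]; congr 1; ring
  have hpow1 : 1 ≤ Real.exp (64 * L / l) := Real.one_le_exp (by positivity)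
  have hbase : ∀ (V : Submodule ℝ (EuclideanSpace ℝ (Fin d))), Module.finrank ℝ V ≤ 2 →
      ∀ T : Finset (EuclideanSpace ℝ (Fin d)), (∀ x ∈ T, x ∈ grid d n) →
      (∀ x ∈ T, ∀ y ∈ T, x - y ∈ V) → (∀ x ∈ T, ‖x - c‖ = ρ) → T.card ≤ ⌊R⌋₊ := by
    intro V hV T hT hTV hTs
    apply Nat.le_floor
    have hE0 : 0 < Real.exp (4 * K / l3) := Real.exp_pos _
    rw [hR, hpow]
    rcases circle_count d n V hV c ρ T hT hTV hTs with h | ⟨N, hN0, hN, h⟩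
    · have : (T.card : ℝ) ≤ 2 := by exact_mod_cast h
      nlinarith
    · have h1 : (T.card : ℝ) ≤ 10 * (N.divisors.card : ℝ) ^ 2 := by exact_mod_cast h
      have h2 := divisor_bound N hN0 l hlpos
      have h3 : Real.log N ≤ K + 8 * L := by
        have e : K + 8 * L = Real.log (5 * (d : ℝ) ^ 4 * (n : ℝ) ^ 8) := by
          rw [Real.log_mul (by positivity) (by positivity), Real.log_pow]; norm_num; rfl
        rw [e]
        apply Real.log_le_log (by exact_mod_cast hN0)
        exact_mod_cast hN
      have h4 : (N.divisors.card : ℝ) ^ 2 ≤ Real.exp (4 * K / l3) * Real.exp (64 * L / l) := by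
        calc (N.divisors.card : ℝ) ^ 2
            ≤ (Real.exp ((2 * Real.log N + 16 * Real.exp l) / l)) ^ 2 := by gcongr
          _ = Real.exp (2 * ((2 * Real.log N + 16 * L) / l)) := by
            rw [← Real.exp_nat_mul, hexpl]; norm_num
          _ ≤ Real.exp (2 * ((2 * (K + 8 * L) + 16 * L) / l)) := by gcongr
          _ = Real.exp (4 * K / l + 64 * L / l) := by congr 1; ring
          _ ≤ Real.exp (4 * K / l3 + 64 * L / l) := by gcongr
          _ = _ := Real.exp_add _ _
      nlinarith
  obtain ⟨j, rfl⟩ : ∃ j, k = j + 1 := ⟨k - 1, by omega⟩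
  have hfin : ((A : Set (EuclideanSpace ℝ (Fin d))) ∩ Metric.sphere c ρ ∩ grid d n).Finite :=
    (grid_finite d n).subset Set.inter_subset_right
  have hmain := slice_count d n (by omega) c ρ ⌊R⌋₊ hbase j A.direction (by omega) hfin.toFinset
    (by intro x hx; exact ((Set.Finite.mem_toFinset _).mp hx).2)
    (by
      intro x hx y hy
      exact AffineSubspace.vsub_mem_direction ((Set.Finite.mem_toFinset _).mp hx).1.1
        ((Set.Finite.mem_toFinset _).mp hy).1.1)
    (by
      intro x hx
      have := ((Set.Finite.mem_toFinset _).mp hx).1.2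
      simpa [dist_eq_norm] using this)
  rw [Set.ncard_eq_toFinset_card _ hfin]
  calc (hfin.toFinset.card : ℝ) ≤ (⌊R⌋₊ : ℝ) * (n : ℝ) ^ j := by exact_mod_cast hmain
    _ ≤ R * (n : ℝ) ^ j := by gcongr; exact Nat.floor_le hR0
    _ = _ := by
      have e : ((j + 1 : ℕ) : ℝ) - 1 + 64 / l = j + 64 / l := by push_cast; ring
      rw [e, Real.rpow_add hn0, Real.rpow_natCast, hR]; ring
end

section
/- Let γ = 4/15 + Σ_{a=2}^∞ Σ_{1 ≤ b < a, gcd(a,b)=1} 2(3+(−1)^{a+b}) f(a,b), where f(a,b) = (20a^6 + 25a^5 b − 7a^4 b^2 + 28a^3 b^3 − 20a^2 b^4 + 3ab^5 − b^6)/(240 a^5 (a+b)^2 (a^2+b^2)). Then 0.35974 < γ < 0.36017. -/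
/-- The rational function `f(a,b)` from the definition of `γ`. -/
noncomputable def fab (a b : ℕ) : ℝ :=
  (20 * (a : ℝ) ^ 6 + 25 * (a : ℝ) ^ 5 * (b : ℝ) - 7 * (a : ℝ) ^ 4 * (b : ℝ) ^ 2
      + 28 * (a : ℝ) ^ 3 * (b : ℝ) ^ 3 - 20 * (a : ℝ) ^ 2 * (b : ℝ) ^ 4
      + 3 * (a : ℝ) * (b : ℝ) ^ 5 - (b : ℝ) ^ 6) /
    (240 * (a : ℝ) ^ 5 * ((a : ℝ) + (b : ℝ)) ^ 2 * ((a : ℝ) ^ 2 + (b : ℝ) ^ 2))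

/-- The constant `γ = 4/15 + Σ_{a≥2} Σ_{1 ≤ b < a, gcd(a,b)=1} 2(3+(−1)^{a+b}) f(a,b)`.
(The summands with `a < 2` are empty sums, so the outer sum may run over all of `ℕ`.) -/
noncomputable def gammaConst : ℝ :=
  4 / 15 + ∑' a : ℕ, ∑ b ∈ (Finset.Ico 1 a).filter (fun b => Nat.gcd a b = 1),
    2 * (3 + (-1 : ℝ) ^ (a + b)) * fab a b

/-! ### Pointwise bounds -/

lemma fab_nonneg (a b : ℕ) (hb : b ≤ a) (ha : 0 < a) : 0 ≤ fab a b := by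
  obtain ⟨c, rfl⟩ := Nat.exists_eq_add_of_le hb
  unfold fab
  apply div_nonneg _ (by positivity)
  push_cast
  have hc : (0:ℝ) ≤ c := by positivity
  have hb : (0:ℝ) ≤ b := by positivity
  ring_nf
  positivity

lemma fab_le (a b : ℕ) (hb : b ≤ a) (ha : 0 < a) :
    fab a b ≤ (1 / 12 + (-(7 / 120) / a) * b + 0 * (b:ℝ)^2) / (a:ℝ)^3 := by
  have ha' : (0:ℝ) < a := by exact_mod_cast ha
  have e : (1 / 12 + (-(7 / 120) / (a:ℝ)) * b + 0 * (b:ℝ)^2) / (a:ℝ)^3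
      = (10 * a - 7 * b) / (120 * (a:ℝ)^4) := by
    field_simp
    ring
  rw [e]
  unfold fab
  rw [div_le_div_iff₀ (by positivity) (by positivity), ← sub_nonneg]
  obtain ⟨c, rfl⟩ := Nat.exists_eq_add_of_le hb
  push_cast
  ring_nf
  positivity

lemma le_fab (a b : ℕ) (hb : b ≤ a) (ha : 0 < a) :
    (1 / 12 + (-(7 / 120 + 11 / 500) / a) * b + (11 / 500 / (a:ℝ)^2) * (b:ℝ)^2) / (a:ℝ)^3
      ≤ fab a b := by
  have ha' : (0:ℝ) < a := by exact_mod_cast ha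
  have e : (1 / 12 + (-(7 / 120 + 11 / 500) / a) * b + (11 / 500 / (a:ℝ)^2) * (b:ℝ)^2) / (a:ℝ)^3
      = (250 * a^2 - 241 * a * b + 66 * b^2) / (3000 * (a:ℝ)^5) := by
    field_simp
    ring
  rw [e]
  unfold fab
  rw [div_le_div_iff₀ (by positivity) (by positivity), ← sub_nonneg]
  obtain ⟨c, rfl⟩ := Nat.exists_eq_add_of_le hb
  push_cast
  ring_nf
  positivity

lemma fab_mul (k a b : ℕ) (hk : k ≠ 0) : fab (k * a) (k * b) = 1 / (k:ℝ)^3 * fab a b := by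
  have hk' : (k:ℝ) ≠ 0 := by exact_mod_cast hk
  unfold fab
  push_cast
  rw [show (240 * ((k:ℝ) * a) ^ 5 * ((k:ℝ) * a + k * b) ^ 2 * (((k:ℝ) * a) ^ 2 + (k * b) ^ 2))
    = (k:ℝ)^6 * ((k:ℝ)^3 * (240 * (a : ℝ) ^ 5 * ((a : ℝ) + (b : ℝ)) ^ 2 * ((a : ℝ) ^ 2 + (b : ℝ) ^ 2)))
    by ring]
  rw [show (20 * ((k:ℝ) * a) ^ 6 + 25 * ((k:ℝ) * a) ^ 5 * (k * b) - 7 * ((k:ℝ) * a) ^ 4 * (k * b) ^ 2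
      + 28 * ((k:ℝ) * a) ^ 3 * (k * b) ^ 3 - 20 * ((k:ℝ) * a) ^ 2 * (k * b) ^ 4
      + 3 * ((k:ℝ) * a) * (k * b) ^ 5 - ((k:ℝ) * b) ^ 6) = (k:ℝ)^6 * (20 * (a : ℝ) ^ 6 + 25 * (a : ℝ) ^ 5 * (b : ℝ) - 7 * (a : ℝ) ^ 4 * (b : ℝ) ^ 2
      + 28 * (a : ℝ) ^ 3 * (b : ℝ) ^ 3 - 20 * (a : ℝ) ^ 2 * (b : ℝ) ^ 4
      + 3 * (a : ℝ) * (b : ℝ) ^ 5 - (b : ℝ) ^ 6) by ring]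
  rw [mul_div_mul_left _ _ (pow_ne_zero 6 hk'), ← div_div, one_div, div_eq_inv_mul _ ((k:ℝ)^3),
    mul_div_assoc]

/-! ### Telescoping bounds for series -/

lemma tele_upper (u G : ℕ → ℝ) (N : ℕ) (hu : ∀ n, 0 ≤ u n) (hG : ∀ n, 0 ≤ G n)
    (h : ∀ n, N ≤ n → u n ≤ G n - G (n + 1)) :
    Summable u ∧ ∑' n, u n ≤ ∑ n ∈ Finset.range N, u n + G N := by
  have key : ∀ k, ∑ n ∈ Finset.range (N + k), u n ≤ ∑ n ∈ Finset.range N, u n + G N - G (N + k) := by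
    intro k
    induction k with
    | zero => simp
    | succ k ih =>
      rw [← add_assoc, Finset.sum_range_succ]
      linarith [h (N + k) (by omega)]
  have key2 : ∀ k, ∑ n ∈ Finset.range k, u n ≤ ∑ n ∈ Finset.range N, u n + G N := by
    intro k
    have h1 := key k
    have h2 : ∑ n ∈ Finset.range k, u n ≤ ∑ n ∈ Finset.range (N + k), u n :=
      Finset.sum_le_sum_of_subset_of_nonneg (Finset.range_mono (by omega)) (fun i _ _ => hu i)
    linarith [hG (N + k)]
  exact ⟨summable_of_sum_range_le hu key2, Real.tsum_le_of_sum_range_le hu key2⟩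

lemma tele_lower (u G : ℕ → ℝ) (N : ℕ) (hs : Summable u)
    (hG : Filter.Tendsto G Filter.atTop (nhds 0))
    (h : ∀ n, N ≤ n → G n - G (n + 1) ≤ u n) :
    ∑ n ∈ Finset.range N, u n + G N ≤ ∑' n, u n := by
  have key : ∀ k, ∑ n ∈ Finset.range N, u n + G N - G (k + N) ≤ ∑ n ∈ Finset.range (k + N), u n := by
    intro k
    induction k with
    | zero => simp
    | succ k ih =>
      rw [show k + 1 + N = k + N + 1 by ring, Finset.sum_range_succ]
      linarith [h (k + N) (by omega)]
  have t1 := (Filter.tendsto_add_atTop_iff_nat N).2 hs.hasSum.tendsto_sum_nat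
  have t2 : Filter.Tendsto (fun k => ∑ n ∈ Finset.range N, u n + G N - G (k + N)) Filter.atTop
      (nhds (∑ n ∈ Finset.range N, u n + G N - 0)) :=
    tendsto_const_nhds.sub ((Filter.tendsto_add_atTop_iff_nat N).2 hG)
  rw [sub_zero] at t2
  exact le_of_tendsto_of_tendsto' t2 t1 key

/-! ### Power sums -/

lemma sum_all (n : ℕ) (x y z : ℝ) :
    ∑ b ∈ Finset.Ico 1 (n + 1), (x + y * b + z * (b:ℝ)^2)
      = x * n + y * (n * (n + 1) / 2) + z * (n * (n + 1) * (2 * n + 1) / 6) := by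
  induction n with
  | zero => simp
  | succ n ih =>
    rw [Finset.sum_Ico_succ_top (by omega), ih]
    push_cast
    ring

lemma sum_odd (m : ℕ) (x y z : ℝ) :
    ∑ b ∈ Finset.Ico 1 (2 * m + 1), ((b % 2 : ℕ) : ℝ) * (x + y * b + z * (b:ℝ)^2)
      = x * m + y * (m:ℝ)^2 + z * (m * (4 * m^2 - 1) / 3) := by
  induction m with
  | zero => simp
  | succ n ih =>
    rw [show 2 * (n + 1) + 1 = 2 * n + 1 + 1 + 1 by ring, Finset.sum_Ico_succ_top (by omega),
      Finset.sum_Ico_succ_top (by omega), ih, show (2 * n + 1) % 2 = 1 by omega,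
      show (2 * n + 1 + 1) % 2 = 0 by omega]
    push_cast
    ring

/-! ### The homogeneity identity -/

lemma homog (F : ℕ × ℕ → ℝ) (c : ℕ → ℝ) (hF0 : F (0, 0) = 0) (hF : Summable F) (hc : Summable c)
    (hFn : ∀ p, 0 ≤ F p) (hc0 : c 0 = 0)
    (h : ∀ k a b, k ≠ 0 → F (k * a, k * b) = c k * F (a, b)) :
    Summable (fun p : ℕ × ℕ => if Nat.gcd p.1 p.2 = 1 then F p else 0) ∧
    ∑' p, F p = (∑' k, c k) * ∑' p : ℕ × ℕ, if Nat.gcd p.1 p.2 = 1 then F p else 0 := by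
  have hs : Summable (fun p : ℕ × ℕ => if Nat.gcd p.1 p.2 = 1 then F p else 0) := by
    refine Summable.of_nonneg_of_le (fun p => ?_) (fun p => ?_) hF
    · split_ifs
      · exact hFn p
      · exact le_rfl
    · split_ifs
      · exact le_rfl
      · exact hFn p
  refine ⟨hs, ?_⟩
  let X : Set (ℕ × (ℕ × ℕ)) := {q | q.1 ≠ 0 ∧ Nat.gcd q.2.1 q.2.2 = 1}
  let i : X → ℕ × ℕ := fun q => (q.1.1 * q.1.2.1, q.1.1 * q.1.2.2)
  have hi : Function.Injective i := by
    rintro ⟨⟨k, a, b⟩, hk, hg⟩ ⟨⟨k', a', b'⟩, hk', hg'⟩ he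
    simp only [i, Prod.mk.injEq] at he hk hk' hg hg'
    obtain ⟨h1, h2⟩ := he
    have hkk : k = k' := by
      have := Nat.gcd_mul_left k a b
      have h3 := Nat.gcd_mul_left k' a' b'
      rw [hg, h1, h2, h3, hg'] at this
      omega
    subst hkk
    have e1 := Nat.eq_of_mul_eq_mul_left (Nat.pos_of_ne_zero hk) h1
    have e2 := Nat.eq_of_mul_eq_mul_left (Nat.pos_of_ne_zero hk) h2
    subst e1 e2
    rfl
  have hsupp : Function.support F ⊆ Set.range i := by
    rintro ⟨a, b⟩ hp
    have hg : 0 < Nat.gcd a b := by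
      rw [Nat.gcd_pos_iff]
      by_contra hcon
      have ha : a = 0 := by omega
      have hb : b = 0 := by omega
      subst ha hb
      exact hp hF0
    refine ⟨⟨(Nat.gcd a b, (a / Nat.gcd a b, b / Nat.gcd a b)), hg.ne', ?_⟩, ?_⟩
    · exact Nat.coprime_div_gcd_div_gcd hg
    · simp only [i, Prod.mk.injEq]
      exact ⟨Nat.mul_div_cancel' (Nat.gcd_dvd_left a b), Nat.mul_div_cancel' (Nat.gcd_dvd_right a b)⟩
  rw [← hi.tsum_eq hsupp]
  have e : ∀ q : X, F (i q) = (fun q : ℕ × (ℕ × ℕ) => c q.1 * F q.2) q := by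
    rintro ⟨⟨k, a, b⟩, hk, hg⟩
    exact h k a b hk
  rw [tsum_congr e, tsum_subtype X (fun q : ℕ × (ℕ × ℕ) => c q.1 * F q.2),
    tsum_mul_tsum_of_summable_norm hc.norm hs.norm]
  refine tsum_congr ?_
  rintro ⟨k, a, b⟩
  by_cases hk : k = 0
  · subst hk
    simp [Set.indicator, hc0]
  · by_cases hg : Nat.gcd a b = 1
    · simp [Set.indicator, X, hk, hg]
    · simp [Set.indicator, X, hg]

/-- Inner sum over all `b`, with weight `χ`. -/
noncomputable def innerAll (χ : ℕ → ℝ) (a : ℕ) : ℝ :=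
  ∑ b ∈ Finset.Ico 1 a, χ a * (χ b * fab a b)

/-- Inner sum over the `b` coprime to `a`, with weight `χ`. -/
noncomputable def innerCop (χ : ℕ → ℝ) (a : ℕ) : ℝ :=
  ∑ b ∈ (Finset.Ico 1 a).filter (fun b => Nat.gcd a b = 1), χ a * (χ b * fab a b)

lemma innerAll_nonneg (χ : ℕ → ℝ) (hχ : ∀ n, 0 ≤ χ n) (a : ℕ) : 0 ≤ innerAll χ a := by
  refine Finset.sum_nonneg fun b hb => ?_
  rw [Finset.mem_Ico] at hb
  exact mul_nonneg (hχ a) (mul_nonneg (hχ b) (fab_nonneg a b hb.2.le (by omega)))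

lemma homog_inner (χ : ℕ → ℝ) (hχ : ∀ n, χ n = 0 ∨ χ n = 1) (hm : ∀ m n, χ (m * n) = χ m * χ n)
    (hA : Summable (innerAll χ)) (hc : Summable (fun k : ℕ => χ k * (1 / (k:ℝ)^3))) :
    Summable (innerCop χ) ∧
    ∑' a, innerAll χ a = (∑' k : ℕ, χ k * (1 / (k:ℝ)^3)) * ∑' a, innerCop χ a := by
  have hχn : ∀ n, 0 ≤ χ n := fun n => by rcases hχ n with h | h <;> rw [h] <;> norm_num
  let F : ℕ × ℕ → ℝ := fun p => if 1 ≤ p.2 ∧ p.2 < p.1 then χ p.1 * (χ p.2 * fab p.1 p.2) else 0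
  have hFn : ∀ p, 0 ≤ F p := by
    rintro ⟨a, b⟩
    simp only [F]
    split_ifs with hb
    · exact mul_nonneg (hχn a) (mul_nonneg (hχn b) (fab_nonneg a b hb.2.le (by omega)))
    · exact le_rfl
  have hrow : ∀ a, HasSum (fun b => F (a, b)) (innerAll χ a) := by
    intro a
    have e : innerAll χ a = ∑ b ∈ Finset.Ico 1 a, F (a, b) := by
      refine Finset.sum_congr rfl fun b hb => ?_
      rw [Finset.mem_Ico] at hb
      simp only [F, if_pos hb]
    rw [e]
    refine hasSum_sum_of_ne_finset_zero fun b hb => ?_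
    rw [Finset.mem_Ico] at hb
    simp only [F, if_neg hb]
  have hrow' : ∀ a, HasSum (fun b => if Nat.gcd a b = 1 then F (a, b) else 0) (innerCop χ a) := by
    intro a
    have e : innerCop χ a = ∑ b ∈ Finset.Ico 1 a, if Nat.gcd a b = 1 then F (a, b) else 0 := by
      unfold innerCop
      rw [Finset.sum_filter]
      refine Finset.sum_congr rfl fun b hb => ?_
      rw [Finset.mem_Ico] at hb
      simp only [F, if_pos hb]
    rw [e]
    refine hasSum_sum_of_ne_finset_zero fun b hb => ?_
    rw [Finset.mem_Ico] at hb
    simp only [F, if_neg hb, ite_self]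
  have hF : Summable F := by
    rw [summable_prod_of_nonneg hFn]
    refine ⟨fun a => (hrow a).summable, ?_⟩
    simpa only [(hrow _).tsum_eq] using hA
  obtain ⟨h1, h2⟩ := homog F (fun k : ℕ => χ k * (1 / (k:ℝ)^3)) (by simp [F]) hF hc hFn
    (by simp) (by
      intro k a b hk
      have e : (1 ≤ k * b ∧ k * b < k * a) ↔ (1 ≤ b ∧ b < a) := by
        rw [Nat.mul_lt_mul_left (Nat.pos_of_ne_zero hk), Nat.one_le_iff_ne_zero,
          Nat.one_le_iff_ne_zero]
        simp [hk]
      simp only [F, e]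
      split_ifs with hb
      · rw [hm, hm, fab_mul k a b hk]
        rcases hχ k with h | h <;> rw [h] <;> ring
      · simp)
  have hs1 := h1.hasSum.prod_fiberwise hrow'
  refine ⟨hs1.summable, ?_⟩
  rw [hs1.tsum_eq, ← h2, hF.tsum_prod]
  exact tsum_congr fun a => (hrow a).tsum_eq.symm

/-! ### The decomposition of `gammaConst` -/

/-- Indicator of the odd numbers. -/
noncomputable def chiOdd (n : ℕ) : ℝ := ((n % 2 : ℕ) : ℝ)

/-- The constant weight. -/
noncomputable def chiOne (_ : ℕ) : ℝ := 1

lemma gamma_term (a : ℕ) : ∑ b ∈ (Finset.Ico 1 a).filter (fun b => Nat.gcd a b = 1),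
    2 * (3 + (-1 : ℝ) ^ (a + b)) * fab a b = 4 * innerCop chiOne a + 4 * innerCop chiOdd a := by
  unfold innerCop
  rw [Finset.mul_sum, Finset.mul_sum, ← Finset.sum_add_distrib]
  refine Finset.sum_congr rfl fun b hb => ?_
  rw [Finset.mem_filter] at hb
  have hg := hb.2
  simp only [chiOne, chiOdd]
  rcases Nat.mod_two_eq_zero_or_one a with ha | ha <;>
    rcases Nat.mod_two_eq_zero_or_one b with hb | hb
  · exfalso
    have := Nat.dvd_gcd (Nat.dvd_of_mod_eq_zero ha) (Nat.dvd_of_mod_eq_zero hb)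
    omega
  · rw [Odd.neg_one_pow (by rw [Nat.odd_iff]; omega), ha, hb]
    push_cast
    ring
  · rw [Odd.neg_one_pow (by rw [Nat.odd_iff]; omega), ha, hb]
    push_cast
    ring
  · rw [Even.neg_one_pow (by rw [Nat.even_iff]; omega), ha, hb]
    push_cast
    ring

lemma gamma_eq (h1 : Summable (innerCop chiOne)) (h2 : Summable (innerCop chiOdd)) :
    gammaConst = 4 / 15 + (4 * ∑' a, innerCop chiOne a + 4 * ∑' a, innerCop chiOdd a) := by
  unfold gammaConst
  rw [tsum_congr gamma_term, (h1.mul_left 4).tsum_add (h2.mul_left 4), tsum_mul_left, tsum_mul_left]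

/-! ### Tails -/

lemma one_upper (a : ℕ) (ha : 1 ≤ a) :
    innerAll chiOne a ≤ 13 / 240 / (a:ℝ) - 13 / 240 / ((a + 1 : ℕ) : ℝ) := by
  have h : innerAll chiOne a ≤ ∑ b ∈ Finset.Ico 1 a,
      (1 / 12 + (-(7 / 120) / a) * b + 0 * (b:ℝ)^2) / (a:ℝ)^3 := by
    refine Finset.sum_le_sum fun b hb => ?_
    rw [Finset.mem_Ico] at hb
    simp only [chiOne, one_mul]
    exact fab_le a b hb.2.le ha
  refine h.trans ?_
  rw [← Finset.sum_div]
  obtain ⟨n, rfl⟩ : ∃ n, a = n + 1 := ⟨a - 1, by omega⟩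
  rw [sum_all]
  push_cast
  rw [div_sub_div _ _ (by positivity) (by positivity), div_le_div_iff₀ (by positivity) (by positivity),
    ← sub_nonneg]
  field_simp
  ring_nf
  positivity

lemma one_lower (a : ℕ) (ha : 101 ≤ a) :
    101 / 2000 / ((a:ℝ) + 1 / 10) - 101 / 2000 / (((a + 1 : ℕ) : ℝ) + 1 / 10)
      ≤ innerAll chiOne a := by
  have h : ∑ b ∈ Finset.Ico 1 a, (1 / 12 + (-(7 / 120 + 11 / 500) / a) * b
      + (11 / 500 / (a:ℝ)^2) * (b:ℝ)^2) / (a:ℝ)^3 ≤ innerAll chiOne a := by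
    refine Finset.sum_le_sum fun b hb => ?_
    rw [Finset.mem_Ico] at hb
    simp only [chiOne, one_mul]
    exact le_fab a b hb.2.le (by omega)
  refine le_trans ?_ h
  rw [← Finset.sum_div]
  obtain ⟨n, rfl⟩ : ∃ n, a = n + 100 + 1 := ⟨a - 101, by omega⟩
  rw [sum_all]
  push_cast
  rw [div_sub_div _ _ (by positivity) (by positivity), div_le_div_iff₀ (by positivity) (by positivity),
    ← sub_nonneg]
  field_simp
  ring_nf
  positivity

lemma odd_split (χA H : ℕ → ℝ) (N : ℕ) (h0 : ∀ m, χA (2 * m) = 0)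
    (h : ∀ m, N ≤ m → χA (2 * m + 1) ≤ H m - H (m + 1)) (a : ℕ) (ha : 2 * N + 1 ≤ a) :
    χA a ≤ H (a / 2) - H ((a + 1) / 2) := by
  rcases Nat.even_or_odd' a with ⟨m, rfl | rfl⟩
  · rw [h0, show 2 * m / 2 = m by omega, show (2 * m + 1) / 2 = m by omega, sub_self]
  · rw [show (2 * m + 1) / 2 = m by omega, show (2 * m + 1 + 1) / 2 = m + 1 by omega]
    exact h m (by omega)

lemma odd_upper (m : ℕ) (hm : 1 ≤ m) :
    innerAll chiOdd (2 * m + 1) ≤ 13 / 1920 / (m:ℝ) - 13 / 1920 / ((m + 1 : ℕ) : ℝ) := by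
  have h : innerAll chiOdd (2 * m + 1) ≤ ∑ b ∈ Finset.Ico 1 (2 * m + 1),
      (((b % 2 : ℕ) : ℝ) * (1 / 12 + (-(7 / 120) / ((2 * m + 1 : ℕ):ℝ)) * b + 0 * (b:ℝ)^2))
        / ((2 * m + 1 : ℕ):ℝ)^3 := by
    refine Finset.sum_le_sum fun b hb => ?_
    rw [Finset.mem_Ico] at hb
    simp only [chiOdd, show (2 * m + 1) % 2 = 1 by omega, Nat.cast_one, one_mul]
    rw [mul_div_assoc]
    exact mul_le_mul_of_nonneg_left (fab_le _ b hb.2.le (by omega)) (by positivity)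
  refine h.trans ?_
  rw [← Finset.sum_div, sum_odd]
  have hm' : (0:ℝ) < m := by exact_mod_cast hm
  push_cast
  rw [div_sub_div _ _ (by positivity) (by positivity), div_le_div_iff₀ (by positivity) (by positivity),
    ← sub_nonneg]
  field_simp
  ring_nf
  positivity

lemma odd_lower (m : ℕ) (hm : 50 ≤ m) :
    101 / 16000 / ((m:ℝ) + 1 / 4) - 101 / 16000 / (((m + 1 : ℕ) : ℝ) + 1 / 4)
      ≤ innerAll chiOdd (2 * m + 1) := by
  have h : ∑ b ∈ Finset.Ico 1 (2 * m + 1),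
      (((b % 2 : ℕ) : ℝ) * (1 / 12 + (-(7 / 120 + 11 / 500) / ((2 * m + 1 : ℕ):ℝ)) * b
        + (11 / 500 / ((2 * m + 1 : ℕ):ℝ)^2) * (b:ℝ)^2))
        / ((2 * m + 1 : ℕ):ℝ)^3 ≤ innerAll chiOdd (2 * m + 1) := by
    refine Finset.sum_le_sum fun b hb => ?_
    rw [Finset.mem_Ico] at hb
    simp only [chiOdd, show (2 * m + 1) % 2 = 1 by omega, Nat.cast_one, one_mul]
    rw [mul_div_assoc]
    exact mul_le_mul_of_nonneg_left (le_fab _ b hb.2.le (by omega)) (by positivity)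
  refine le_trans ?_ h
  rw [← Finset.sum_div, sum_odd]
  obtain ⟨n, rfl⟩ : ∃ n, m = n + 50 := ⟨m - 50, by omega⟩
  push_cast
  rw [div_sub_div _ _ (by positivity) (by positivity), div_le_div_iff₀ (by positivity) (by positivity),
    ← sub_nonneg]
  field_simp
  ring_nf
  positivity

lemma innerAll_even (m : ℕ) : innerAll chiOdd (2 * m) = 0 := by
  refine Finset.sum_eq_zero fun b _ => ?_
  simp [chiOdd]

/-! ### Finite parts -/

/-- Floor of `10 ^ 12 * fab a b` (for `b ≤ a`), computed with natural numbers. -/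
def fl (a b : ℕ) : ℕ :=
  10 ^ 12 * ((20 * a ^ 6 + 25 * a ^ 5 * b + 28 * a ^ 3 * b ^ 3 + 3 * a * b ^ 5)
    - (7 * a ^ 4 * b ^ 2 + 20 * a ^ 2 * b ^ 4 + b ^ 6))
    / (240 * a ^ 5 * (a + b) ^ 2 * (a ^ 2 + b ^ 2))

lemma fl_bounds (a b : ℕ) (hb : b ≤ a) (ha : 0 < a) :
    (fl a b : ℝ) ≤ 10 ^ 12 * fab a b ∧ 10 ^ 12 * fab a b ≤ fl a b + 1 := by
  have hle : 7 * a ^ 4 * b ^ 2 + 20 * a ^ 2 * b ^ 4 + b ^ 6 ≤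
      20 * a ^ 6 + 25 * a ^ 5 * b + 28 * a ^ 3 * b ^ 3 + 3 * a * b ^ 5 := by
    obtain ⟨c, rfl⟩ := Nat.exists_eq_add_of_le hb
    zify
    rw [← sub_nonneg]
    ring_nf
    positivity
  have e : 10 ^ 12 * fab a b = ((10 ^ 12 * ((20 * a ^ 6 + 25 * a ^ 5 * b + 28 * a ^ 3 * b ^ 3 + 3 * a * b ^ 5)
    - (7 * a ^ 4 * b ^ 2 + 20 * a ^ 2 * b ^ 4 + b ^ 6)) : ℕ) : ℝ) /
      ((240 * a ^ 5 * (a + b) ^ 2 * (a ^ 2 + b ^ 2) : ℕ) : ℝ) := by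
    rw [Nat.cast_mul, Nat.cast_sub hle]
    unfold fab
    push_cast
    rw [← mul_div_assoc]
    congr 1
    ring
  rw [e]
  unfold fl
  refine ⟨Nat.cast_div_le, ?_⟩
  rw [← Nat.floor_div_eq_div (K := ℝ)]
  exact (Nat.lt_floor_add_one _).le

/-- The finite sum of floors. -/
def flSum (w : ℕ → ℕ) : ℕ :=
  ∑ a ∈ Finset.range 101, ∑ b ∈ Finset.Ico 1 a, w a * (w b * fl a b)

/-- The number of (weighted) terms. -/
def cntSum (w : ℕ → ℕ) : ℕ :=
  ∑ a ∈ Finset.range 101, ∑ b ∈ Finset.Ico 1 a, w a * (w b * 1)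

lemma flSum_bounds (w : ℕ → ℕ) (χ : ℕ → ℝ) (h : ∀ n, χ n = (w n : ℝ)) :
    (flSum w : ℝ) ≤ 10 ^ 12 * ∑ a ∈ Finset.range 101, innerAll χ a ∧
    10 ^ 12 * ∑ a ∈ Finset.range 101, innerAll χ a ≤ flSum w + cntSum w := by
  unfold flSum cntSum innerAll
  push_cast
  simp only [← Finset.sum_add_distrib, Finset.mul_sum]
  constructor <;> refine Finset.sum_le_sum fun a _ => Finset.sum_le_sum fun b hb => ?_
  all_goals
    rw [Finset.mem_Ico] at hb
    obtain ⟨h1, h2⟩ := fl_bounds a b hb.2.le (by omega)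
    rw [h, h]
    have hw : (0:ℝ) ≤ (w a : ℝ) * w b := by positivity
  · nlinarith [mul_le_mul_of_nonneg_left h1 hw]
  · nlinarith [mul_le_mul_of_nonneg_left h2 hw]

set_option maxRecDepth 100000 in
lemma flSum_one : 21620100000 ≤ flSum (fun _ => 1) ∧
    flSum (fun _ => 1) + cntSum (fun _ => 1) ≤ 21620300000 := by
  decide +kernel

set_option maxRecDepth 100000 in
lemma flSum_odd : 5000200000 ≤ flSum (fun n => n % 2) ∧
    flSum (fun n => n % 2) + cntSum (fun n => n % 2) ≤ 5000250000 := by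
  decide +kernel

/-! ### The four constants -/

lemma S_one : Summable (innerAll chiOne) ∧ 0.022119 ≤ ∑' a, innerAll chiOne a ∧
    ∑' a, innerAll chiOne a ≤ 0.022157 := by
  obtain ⟨f1, f2⟩ := flSum_bounds (fun _ => 1) chiOne (fun n => by simp [chiOne])
  obtain ⟨g1, g2⟩ := flSum_one
  generalize flSum (fun _ => 1) = s at *
  generalize cntSum (fun _ => 1) = t at *
  replace g1 : (21620100000 : ℝ) ≤ (s : ℝ) := by exact_mod_cast g1
  replace g2 : (s : ℝ) + (t : ℝ) ≤ (21620300000 : ℝ) := by exact_mod_cast g2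
  obtain ⟨hs, hu⟩ := tele_upper (innerAll chiOne) (fun a => 13 / 240 / (a:ℝ)) 101
    (innerAll_nonneg _ (fun n => by simp [chiOne])) (fun n => by positivity)
    (fun n hn => one_upper n (by omega))
  have hl := tele_lower (innerAll chiOne) (fun a => 101 / 2000 / ((a:ℝ) + 1 / 10)) 101 hs
    (Filter.Tendsto.const_div_atTop
      (Filter.tendsto_atTop_add_const_right _ _ tendsto_natCast_atTop_atTop) _)
    (fun n hn => one_lower n hn)
  generalize (∑ a ∈ Finset.range 101, innerAll chiOne a) = P at *
  refine ⟨hs, ?_, ?_⟩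
  · norm_num at hl f1 f2 ⊢
    linarith
  · norm_num at hu f1 f2 ⊢
    linarith

lemma S_odd : Summable (innerAll chiOdd) ∧ 0.0051258 ≤ ∑' a, innerAll chiOdd a ∧
    ∑' a, innerAll chiOdd a ≤ 0.0051357 := by
  obtain ⟨f1, f2⟩ := flSum_bounds (fun n => n % 2) chiOdd (fun n => rfl)
  obtain ⟨g1, g2⟩ := flSum_odd
  generalize flSum (fun n => n % 2) = s at *
  generalize cntSum (fun n => n % 2) = t at *
  replace g1 : (5000200000 : ℝ) ≤ (s : ℝ) := by exact_mod_cast g1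
  replace g2 : (s : ℝ) + (t : ℝ) ≤ (5000250000 : ℝ) := by exact_mod_cast g2
  obtain ⟨hs, hu⟩ := tele_upper (innerAll chiOdd) (fun a => 13 / 1920 / ((a / 2 : ℕ):ℝ)) 101
    (innerAll_nonneg _ (fun n => by simp [chiOdd])) (fun n => by positivity)
    (fun n hn => odd_split (innerAll chiOdd) (fun m => 13 / 1920 / (m:ℝ)) 50 innerAll_even
      (fun m hm => odd_upper m (by omega)) n hn)
  have ht : Filter.Tendsto (fun m : ℕ => 101 / 16000 / ((m:ℝ) + 1 / 4)) Filter.atTop (nhds 0) :=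
    Filter.Tendsto.const_div_atTop
      (Filter.tendsto_atTop_add_const_right _ _ tendsto_natCast_atTop_atTop) _
  have hl := tele_lower (innerAll chiOdd) (fun a => 101 / 16000 / (((a / 2 : ℕ):ℝ) + 1 / 4)) 101 hs
    (ht.comp (Nat.tendsto_div_const_atTop (by norm_num)))
    (fun n hn => by
      have := odd_split (fun a => - innerAll chiOdd a) (fun m => - (101 / 16000 / ((m:ℝ) + 1 / 4))) 50
        (fun m => by simp [innerAll_even])
        (fun m hm => by linarith [odd_lower m hm]) n hn
      linarith)
  generalize (∑ a ∈ Finset.range 101, innerAll chiOdd a) = P at *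
  refine ⟨hs, ?_, ?_⟩
  · norm_num at hl f1 f2 ⊢
    linarith
  · norm_num at hu f1 f2 ⊢
    linarith

lemma Z_one : Summable (fun k : ℕ => chiOne k * (1 / (k:ℝ)^3)) ∧
    1.2015 ≤ ∑' k : ℕ, chiOne k * (1 / (k:ℝ)^3) ∧
    ∑' k : ℕ, chiOne k * (1 / (k:ℝ)^3) ≤ 1.2021 := by
  have hn : ∀ k : ℕ, 0 ≤ chiOne k * (1 / (k:ℝ)^3) := fun k => by unfold chiOne; positivity
  obtain ⟨hs, hu⟩ := tele_upper (fun k : ℕ => chiOne k * (1 / (k:ℝ)^3))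
    (fun k => 1 / (2 * ((k:ℝ) * (k - 1)))) 41 hn
    (fun n => by
      rcases n with _ | n
      · simp
      · push_cast
        rw [add_sub_cancel_right]
        positivity)
    (fun n hn => by
      obtain ⟨k, rfl⟩ : ∃ k, n = k + 2 := ⟨n - 2, by omega⟩
      simp only [chiOne, one_mul]
      push_cast
      rw [show (k:ℝ) + 2 - 1 = k + 1 by ring, show (k:ℝ) + 2 + 1 - 1 = k + 2 by ring,
        div_sub_div _ _ (by positivity) (by positivity),
        div_le_div_iff₀ (by positivity) (by positivity), ← sub_nonneg]
      ring_nf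
      positivity)
  have hl := hs.sum_le_tsum (Finset.range 41) (fun i _ => hn i)
  refine ⟨hs, le_trans ?_ hl, hu.trans ?_⟩
  · norm_num [Finset.sum_range_succ, chiOne]
  · norm_num [Finset.sum_range_succ, chiOne]

lemma Z_odd : Summable (fun k : ℕ => chiOdd k * (1 / (k:ℝ)^3)) ∧
    1.0515 ≤ ∑' k : ℕ, chiOdd k * (1 / (k:ℝ)^3) ∧
    ∑' k : ℕ, chiOdd k * (1 / (k:ℝ)^3) ≤ 1.052 := by
  have hn : ∀ k : ℕ, 0 ≤ chiOdd k * (1 / (k:ℝ)^3) := fun k => by unfold chiOdd; positivity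
  obtain ⟨hs, hu⟩ := tele_upper (fun k : ℕ => chiOdd k * (1 / (k:ℝ)^3))
    (fun k => 1 / (16 * ((k / 2 : ℕ):ℝ)^2)) 41 hn (fun n => by positivity)
    (fun n hn => odd_split (fun k : ℕ => chiOdd k * (1 / (k:ℝ)^3)) (fun m => 1 / (16 * (m:ℝ)^2)) 20
      (fun m => by simp [chiOdd])
      (fun m hm => by
        have hm' : (0:ℝ) < m := by
          have : 0 < m := by omega
          exact_mod_cast this
        simp only [chiOdd, show (2 * m + 1) % 2 = 1 by omega, Nat.cast_one, one_mul]
        push_cast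
        rw [div_sub_div _ _ (by positivity) (by positivity),
          div_le_div_iff₀ (by positivity) (by positivity), ← sub_nonneg]
        ring_nf
        positivity) n hn)
  have hl := hs.sum_le_tsum (Finset.range 41) (fun i _ => hn i)
  refine ⟨hs, le_trans ?_ hl, hu.trans ?_⟩
  · norm_num [Finset.sum_range_succ, chiOdd]
  · norm_num [Finset.sum_range_succ, chiOdd]

theorem gammaConst_bounds : 0.35974 < gammaConst ∧ gammaConst < 0.36017 := by
  obtain ⟨s1, l1, u1⟩ := S_one
  obtain ⟨s2, l2, u2⟩ := S_odd
  obtain ⟨t1, p1, q1⟩ := Z_one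
  obtain ⟨t2, p2, q2⟩ := Z_odd
  obtain ⟨c1, e1⟩ := homog_inner chiOne (fun n => Or.inr rfl) (fun m n => by simp [chiOne]) s1 t1
  obtain ⟨c2, e2⟩ := homog_inner chiOdd
    (fun n => by
      unfold chiOdd
      rcases Nat.mod_two_eq_zero_or_one n with h | h <;> rw [h] <;> simp)
    (fun m n => by
      unfold chiOdd
      rcases Nat.mod_two_eq_zero_or_one n with h | h <;>
        rcases Nat.mod_two_eq_zero_or_one m with h' | h' <;> simp [Nat.mul_mod, h, h']) s2 t2
  rw [gamma_eq c1 c2]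
  rw [e1] at l1 u1
  rw [e2] at l2 u2
  generalize (∑' k : ℕ, chiOne k * (1 / (k:ℝ)^3)) = z at *
  generalize (∑' k : ℕ, chiOdd k * (1 / (k:ℝ)^3)) = y at *
  generalize (∑' a, innerCop chiOne a) = T at *
  generalize (∑' a, innerCop chiOdd a) = O at *
  have hT : 0 < T := by
    by_contra hcon
    nlinarith
  have hO : 0 < O := by
    by_contra hcon
    nlinarith
  have a1 : 0.022119 ≤ 1.2021 * T := l1.trans (mul_le_mul_of_nonneg_right q1 hT.le)
  have a2 : 0.0051258 ≤ 1.052 * O := l2.trans (mul_le_mul_of_nonneg_right q2 hO.le)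
  have b1 : 1.2015 * T ≤ 0.022157 := (mul_le_mul_of_nonneg_right p1 hT.le).trans u1
  have b2 : 1.0515 * O ≤ 0.0051357 := (mul_le_mul_of_nonneg_right p2 hO.le).trans u2
  norm_num at a1 a2 b1 b2 ⊢
  constructor <;> linarith
end
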